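/- arXiv:2210.13174 — 2 statements merged into one kernel-verified Lean document; each statement's English description precedes it below -/
import Mathlib

section
/- Rank-three evaluation: zonal spherical function (Theorem 7.2): Consider the type B/C lattice model of rank 3 with partition λ = (λ₁ ≥ λ₂ ≥ λ₃ ≥ 0). (1) If the bend weights satisfy Bⱼ = Cⱼ with Aⱼ, Cⱼ, Dⱼ ∈ ℂ[q], Cⱼ ≠ 0 for j = 1, 2, 3, A₁ = D₃ = 0, and A₃C₂D₁ = A₃C₁D₂ = A₂C₃D₁ = (1−q²)·C₁C₂C₃, then Z_λ = (C₁C₂C₃/c_λ(q))·Σ_{w∈W} w( x₁^{λ₁+1}x₂^{λ₂+1}x₃^{λ₃+1}·∏_{t∈T} (1−q·t)/(1−t) ). (2) If instead Bⱼ = q·mⱼ·xⱼ and Cⱼ = mⱼ·xⱼ⁻¹ with mⱼ, Aⱼ, Dⱼ ∈ ℂ[q], mⱼ ≠ 0, A₁ = D₃ = 0, m₁A₃D₂ = m₃A₂D₁ = (q³−q)·m₁m₂m₃, and m₂A₃D₁ = (q⁵−q³)·m₁m₂m₃, then Z_λ = (m₁m₂m₃/c_λ(q))·Σ_{w∈W}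 w( x₁^{λ₁}x₂^{λ₂}x₃^{λ₃}·∏_{t∈T} (1−q·t)/(1−t) ). Here T = { x₂/x₁, x₃/x₁, x₃/x₂, (x₁x₂)⁻¹, (x₁x₃)⁻¹, (x₂x₃)⁻¹, x₁⁻², x₂⁻², x₃⁻² } and c_λ(q) = 1 if λ₁ > λ₂ > λ₃; c_λ(q) = 1 + q if exactly two of λ₁, λ₂, λ₃ are equal; c_λ(q) = (1+q)(1+q+q²) if λ₁ = λ₂ = λ₃. -/
noncomputable section

/-- Bosonic six-vertex Boltzmann weight `w_z(h_l, h_r, a, b)` (left horizontal label,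
right horizontal label, top vertical multiplicity, bottom vertical multiplicity). -/
def sixw {F : Type} [Field F] (q z : F) : Bool → Bool → ℕ → ℕ → F
  | false, false, a, b => if a = b then 1 else 0
  | true,  true,  a, b => if a = b then z else 0
  | false, true,  a, b => if a = b + 1 then 1 - q ^ a else 0
  | true,  false, a, b => if b = a + 1 then z else 0

/-- Bend weight selector; the arguments are the left-boundary labels of the two rows
meeting the bend (top row of the pair first, bottom row second). -/
def bendw {F : Type} [Field F] (A B C D : F) : Bool → Bool → F
  | false, false => A
  | true,  false => C
  | false, true  => B
  | true,  true  => D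

/-- A state of the type B/C lattice model of rank `r` with bottom boundary given by the
partition `lam` and `L+1` columns: `m s c` is the multiplicity on the vertical edge
below row `s` (0-indexed from the bottom) in column `c`, and `h s c` is the occupancy of
the horizontal edge to the left of column `c` in row `s`. -/
structure BCState (r : ℕ) (lam : Fin r → ℕ) (L : ℕ) where
  m : Fin (2*r+1) → Fin (L+1) → ℕ
  h : Fin (2*r) → Fin (L+2) → Bool
  bottom : ∀ c : Fin (L+1), m 0 c = (Finset.univ.filter (fun i => lam i = c.val)).card
  top : ∀ c : Fin (L+1), m (Fin.last (2*r)) c = 0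
  right : ∀ s : Fin (2*r), h s (Fin.last (L+1)) = false

/-- The spectral parameter of row `s` (0-indexed from the bottom): row `2i-1` (1-indexed)
carries `xᵢ⁻¹` and row `2i` carries `xᵢ`. -/
def rowp {F : Type} [Field F] {r : ℕ} (x : Fin r → F) (s : Fin (2*r)) : F :=
  if s.val % 2 = 0 then (x ⟨s.val / 2, by have := s.isLt; omega⟩)⁻¹
  else x ⟨s.val / 2, by have := s.isLt; omega⟩

/-- The Boltzmann weight of a state: the product of the six-vertex weights at all
tetravalent vertices times the product of the bend weights. -/
def stateWeight {F : Type} [Field F] {r : ℕ} {lam : Fin r → ℕ} {L : ℕ}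
    (q : F) (x : Fin r → F) (A B C D : Fin r → F) (st : BCState r lam L) : F :=
  (∏ s : Fin (2*r), ∏ c : Fin (L+1),
      sixw q (rowp x s) (st.h s c.castSucc) (st.h s c.succ)
        (st.m s.succ c) (st.m s.castSucc c)) *
  ∏ i : Fin r,
      bendw (A i) (B i) (C i) (D i)
        (st.h ⟨2*i.val+1, by have := i.isLt; omega⟩ 0)
        (st.h ⟨2*i.val, by have := i.isLt; omega⟩ 0)

/-- The partition function of the type B/C lattice model: the sum of the weights of all
states (only finitely many have nonzero weight). -/
def ZBC {F : Type} [Field F] {r : ℕ} (lam : Fin r → ℕ) (L : ℕ)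
    (q : F) (x : Fin r → F) (A B C D : Fin r → F) : F :=
  ∑ᶠ st : BCState r lam L, stateWeight q x A B C D st

/-- `ℂ(q, x₁, x₂, x₃)`. -/
abbrev F3 : Type := FractionRing (MvPolynomial (Fin 4) ℂ)

/-- The element `q` of `ℂ(q, x₁, x₂, x₃)`. -/
def q3 : F3 := algebraMap (MvPolynomial (Fin 4) ℂ) F3 (MvPolynomial.X 0)

/-- The elements `x₁, x₂, x₃`. -/
def x3v (i : Fin 3) : F3 :=
  algebraMap (MvPolynomial (Fin 4) ℂ) F3 (MvPolynomial.X i.succ)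

/-- The embedding of the constants `ℂ`. -/
def cC3 : ℂ →+* F3 :=
  (algebraMap (MvPolynomial (Fin 4) ℂ) F3).comp MvPolynomial.C

/-- `a` lies in `ℂ[q] ⊆ ℂ(q, x₁, x₂, x₃)`. -/
def IsPolyQ3 (a : F3) : Prop :=
  ∃ p : Polynomial ℂ, a = Polynomial.eval₂ cC3 q3 p

/-- The sum `Σ_{w ∈ W} w(f)` over the hyperoctahedral group `W` of rank 3 (order 48),
where `f` is given by the formula `g` evaluated at `(x₁, x₂, x₃)`: the action of `w` is
by permuting the variables and inverting a subset of them. -/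
def WSum3 (g : (Fin 3 → F3) → F3) : F3 :=
  ∑ σ : Equiv.Perm (Fin 3), ∑ ε : Fin 3 → Bool,
    g fun i => if ε i then (x3v (σ i))⁻¹ else x3v (σ i)

/-- The product `∏_{t ∈ T} (1 − q·t)/(1 − t)` over
`T = {x₂/x₁, x₃/x₁, x₃/x₂, (x₁x₂)⁻¹, (x₁x₃)⁻¹, (x₂x₃)⁻¹, x₁⁻², x₂⁻², x₃⁻²}`,
evaluated at variables `y`. -/
def Tprod3 (y : Fin 3 → F3) : F3 :=
  ((1 - q3 * (y 1 / y 0)) / (1 - y 1 / y 0)) *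
  ((1 - q3 * (y 2 / y 0)) / (1 - y 2 / y 0)) *
  ((1 - q3 * (y 2 / y 1)) / (1 - y 2 / y 1)) *
  ((1 - q3 * (y 0 * y 1)⁻¹) / (1 - (y 0 * y 1)⁻¹)) *
  ((1 - q3 * (y 0 * y 2)⁻¹) / (1 - (y 0 * y 2)⁻¹)) *
  ((1 - q3 * (y 1 * y 2)⁻¹) / (1 - (y 1 * y 2)⁻¹)) *
  ((1 - q3 * (y 0 ^ 2)⁻¹) / (1 - (y 0 ^ 2)⁻¹)) *
  ((1 - q3 * (y 1 ^ 2)⁻¹) / (1 - (y 1 ^ 2)⁻¹)) *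
  ((1 - q3 * (y 2 ^ 2)⁻¹) / (1 - (y 2 ^ 2)⁻¹))

/-- The normalizing constant `c_λ(q)` in rank 3. -/
def c3 (l1 l2 l3 : ℕ) : F3 :=
  if l1 = l2 ∧ l2 = l3 then (1 + q3) * (1 + q3 + q3 ^ 2)
  else if l1 = l2 ∨ l2 = l3 then 1 + q3
  else 1

section helpers

variable {F : Type} [Field F]

/-- Row operator, recursively on the list of column multiplicities (column 0 first). -/
def Taux (q z : F) : List ℕ → Bool → (List ℕ → F) → F
  | [], false, f => f []
  | [], true, _ => 0
  | b :: μ, false, f => Taux q z μ false (fun ν => f (b :: ν)) +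
      (1 - q ^ (b + 1)) * Taux q z μ true (fun ν => f ((b + 1) :: ν))
  | 0 :: μ, true, f => z * Taux q z μ true (fun ν => f (0 :: ν))
  | (b + 1) :: μ, true, f => z * Taux q z μ true (fun ν => f ((b + 1) :: ν)) +
      z * Taux q z μ false (fun ν => f (b :: ν))

lemma Taux_add (q z : F) (μ : List ℕ) : ∀ (h : Bool) (f g : List ℕ → F),
    Taux q z μ h (fun ν => f ν + g ν) = Taux q z μ h f + Taux q z μ h g := by
  induction μ with
  | nil => intro h f g; cases h <;> simp [Taux]
  | cons b μ ih =>
    intro h f g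
    cases h
    · simp only [Taux, ih]; ring
    · cases b <;> simp only [Taux, ih] <;> ring

lemma Taux_smul (q z a : F) (μ : List ℕ) : ∀ (h : Bool) (f : List ℕ → F),
    Taux q z μ h (fun ν => a * f ν) = a * Taux q z μ h f := by
  induction μ with
  | nil => intro h f; cases h <;> simp [Taux]
  | cons b μ ih =>
    intro h f
    cases h
    · simp only [Taux, ih]; ring
    · cases b <;> simp only [Taux, ih] <;> ring

/-- Row operator as a linear map. -/
def TL (q z : F) (h : Bool) : (List ℕ → F) →ₗ[F] (List ℕ → F) where
  toFun f μ := Taux q z μ h f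
  map_add' f g := by funext μ; exact Taux_add q z μ h f g
  map_smul' a f := by funext μ; exact Taux_smul q z a μ h f

lemma TL_apply (q z : F) (h : Bool) (f : List ℕ → F) (μ : List ℕ) :
    TL q z h f μ = Taux q z μ h f := rfl

/-- Two-row operator. -/
def T2 (q z w : F) (h k : Bool) (μ : List ℕ) (f : List ℕ → F) : F :=
  Taux q z μ h (fun ν => Taux q w ν k f)

lemma T2_nil (q z w : F) (h k : Bool) (f : List ℕ → F) :
    T2 q z w h k [] f = if h = false ∧ k = false then f [] else 0 := by
  cases h <;> cases k <;> simp [T2, Taux]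

lemma T2_00 (q z w : F) (b : ℕ) (μ : List ℕ) (f : List ℕ → F) :
    T2 q z w false false (b :: μ) f = T2 q z w false false μ (fun ν => f (b :: ν))
      + (1 - q ^ (b+1)) * T2 q z w false true μ (fun ν => f ((b+1) :: ν))
      + (1 - q ^ (b+1)) * (T2 q z w true false μ (fun ν => f ((b+1) :: ν))
      + (1 - q ^ (b+2)) * T2 q z w true true μ (fun ν => f ((b+2) :: ν))) := by
  simp only [T2, Taux, Taux_add, Taux_smul]

lemma T2_01s (q z w : F) (b : ℕ) (μ : List ℕ) (f : List ℕ → F) :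
    T2 q z w false true ((b+1) :: μ) f = w * T2 q z w false true μ (fun ν => f ((b+1) :: ν))
      + w * T2 q z w false false μ (fun ν => f (b :: ν))
      + (1 - q ^ (b+2)) * (w * T2 q z w true true μ (fun ν => f ((b+2) :: ν))
      + w * T2 q z w true false μ (fun ν => f ((b+1) :: ν))) := by
  simp only [T2, Taux, Taux_add, Taux_smul]

lemma T2_01z (q z w : F) (μ : List ℕ) (f : List ℕ → F) :
    T2 q z w false true (0 :: μ) f = w * T2 q z w false true μ (fun ν => f (0 :: ν))
      + (1 - q) * (w * T2 q z w true true μ (fun ν => f (1 :: ν))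
      + w * T2 q z w true false μ (fun ν => f (0 :: ν))) := by
  simp only [T2, Taux, Taux_add, Taux_smul, zero_add, pow_one]

lemma T2_10s (q z w : F) (b : ℕ) (μ : List ℕ) (f : List ℕ → F) :
    T2 q z w true false ((b+1) :: μ) f = z * (T2 q z w true false μ (fun ν => f ((b+1) :: ν))
      + (1 - q ^ (b+2)) * T2 q z w true true μ (fun ν => f ((b+2) :: ν)))
      + z * (T2 q z w false false μ (fun ν => f (b :: ν))
      + (1 - q ^ (b+1)) * T2 q z w false true μ (fun ν => f ((b+1) :: ν))) := by
  simp only [T2, Taux, Taux_add, Taux_smul]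

lemma T2_10z (q z w : F) (μ : List ℕ) (f : List ℕ → F) :
    T2 q z w true false (0 :: μ) f = z * (T2 q z w true false μ (fun ν => f (0 :: ν))
      + (1 - q) * T2 q z w true true μ (fun ν => f (1 :: ν))) := by
  simp only [T2, Taux, Taux_add, Taux_smul, zero_add, pow_one]

lemma T2_11z (q z w : F) (μ : List ℕ) (f : List ℕ → F) :
    T2 q z w true true (0 :: μ) f = z * (w * T2 q z w true true μ (fun ν => f (0 :: ν))) := by
  simp only [T2, Taux, Taux_smul]

lemma T2_11o (q z w : F) (μ : List ℕ) (f : List ℕ → F) :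
    T2 q z w true true (1 :: μ) f = z * (w * T2 q z w true true μ (fun ν => f (1 :: ν))
      + w * T2 q z w true false μ (fun ν => f (0 :: ν)))
      + z * (w * T2 q z w false true μ (fun ν => f (0 :: ν))) := by
  simp only [T2, Taux, Taux_add, Taux_smul]

lemma T2_11s (q z w : F) (b : ℕ) (μ : List ℕ) (f : List ℕ → F) :
    T2 q z w true true ((b+2) :: μ) f = z * (w * T2 q z w true true μ (fun ν => f ((b+2) :: ν))
      + w * T2 q z w true false μ (fun ν => f ((b+1) :: ν)))
      + z * (w * T2 q z w false true μ (fun ν => f ((b+1) :: ν))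
      + w * T2 q z w false false μ (fun ν => f (b :: ν))) := by
  simp only [T2, Taux, Taux_add, Taux_smul]

/-- The Yang--Baxter exchange relations. -/
lemma YB (q : F) (μ : List ℕ) : ∀ (z w : F) (f : List ℕ → F),
    T2 q z w false false μ f = T2 q w z false false μ f ∧
    T2 q z w true true μ f = T2 q w z true true μ f ∧
    T2 q z w false true μ f + T2 q z w true false μ f
      = T2 q w z false true μ f + T2 q w z true false μ f ∧
    (w - z) * T2 q z w false true μ f = (w - q * z) * T2 q w z true false μ f
      - (1 - q) * w * T2 q z w true false μ f := by
  induction μ with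
  | nil => intro z w f; simp [T2_nil]
  | cons b μ ih =>
    intro z w f
    have I1 := fun g => (ih z w g).1
    have I2 := fun g => (ih z w g).2.1
    have I3 := fun g => (ih z w g).2.2.1
    have I4 := fun g => (ih z w g).2.2.2
    have I5 := fun g => (ih w z g).2.2.2
    refine ⟨?_, ?_, ?_, ?_⟩
    · rw [T2_00, T2_00, I1, I2]
      linear_combination (1 - q^(b+1)) * I3 (fun ν => f ((b+1) :: ν))
    · rcases b with _ | _ | b
      · rw [T2_11z, T2_11z, I2]; ring
      · simp only [zero_add]
        rw [T2_11o, T2_11o, I2]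
        linear_combination z * w * I3 (fun ν => f (0 :: ν))
      · rw [T2_11s, T2_11s, I2, I1]
        linear_combination z * w * I3 (fun ν => f ((b+1) :: ν))
    · rcases b with _ | b
      · rw [T2_01z, T2_01z, T2_10z, T2_10z, I2]
        linear_combination I4 (fun ν => f (0 :: ν)) + z * I3 (fun ν => f (0 :: ν))
      · rw [T2_01s, T2_01s, T2_10s, T2_10s, I1, I2]
        linear_combination (z + w - w * q^(b+1)) * I3 (fun ν => f ((b+1) :: ν))
          + q^(b+1) * I4 (fun ν => f ((b+1) :: ν))
    · rcases b with _ | b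
      · rw [T2_01z, T2_10z, T2_10z, I2]
        linear_combination w * I4 (fun ν => f (0 :: ν))
      · rw [T2_01s, T2_10s, T2_10s, I1, I2]
        linear_combination w * (w - q * z) * (1 - q^(b+1)) * I3 (fun ν => f ((b+1) :: ν))
          + w * q^(b+1) * I4 (fun ν => f ((b+1) :: ν))

lemma TL_comm0 (q z w : F) (f : List ℕ → F) :
    TL q z false (TL q w false f) = TL q w false (TL q z false f) := by
  funext μ; exact (YB q μ z w f).1

lemma TL_comm1 (q z w : F) (f : List ℕ → F) :
    TL q z true (TL q w true f) = TL q w true (TL q z true f) := by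
  funext μ; exact (YB q μ z w f).2.1

/-- exchange coefficient -/
def al (q z w : F) : F := (w - q * z) / (w - z)

/-- exchange coefficient -/
def be (q z w : F) : F := -((1 - q) * w / (w - z))

lemma TL_exch (q : F) {z w : F} (hzw : w ≠ z) (f : List ℕ → F) :
    TL q z false (TL q w true f) = al q z w • TL q w true (TL q z false f)
      + be q z w • TL q z true (TL q w false f) := by
  funext μ
  have h := (YB q μ z w f).2.2.2
  have h0 : w - z ≠ 0 := sub_ne_zero.mpr hzw
  change T2 q z w false true μ f = al q z w * T2 q w z true false μ f
    + be q z w * T2 q z w true false μ f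
  unfold al be
  field_simp
  linear_combination h

/-- vacuum indicator -/
def del : List ℕ → F
  | [] => 1
  | 0 :: μ => del μ
  | (_ + 1) :: _ => 0

lemma Taux_zero (q z : F) (μ : List ℕ) (h : Bool) : Taux q z μ h (fun _ => (0 : F)) = 0 := by
  have := Taux_smul q z 0 μ h (fun _ => (0 : F))
  simpa using this

lemma TL_del (q z : F) : TL q z false (del : List ℕ → F) = del := by
  funext μ
  rw [TL_apply]
  induction μ with
  | nil => simp [Taux]
  | cons b μ ih =>
    cases b with
    | zero => simp only [Taux, del, Taux_zero, mul_zero, add_zero]; exact ih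
    | succ b => simp only [Taux, del, Taux_zero, mul_zero, add_zero]

/-- `f` is supported on lists of total multiplicity `k`. -/
def SuppOn (k : ℕ) (f : List ℕ → F) : Prop := ∀ μ : List ℕ, μ.sum ≠ k → f μ = 0

lemma SuppOn_del : SuppOn 0 (del : List ℕ → F) := by
  intro μ
  induction μ with
  | nil => intro h; simp at h
  | cons b μ ih =>
    intro h
    cases b with
    | zero => simp only [del]; apply ih; simpa using h
    | succ b => simp [del]

lemma Taux_supp (q z : F) (μ : List ℕ) : ∀ (h : Bool) (k : ℕ) (f : List ℕ → F),
    (∀ ν : List ℕ, ν.sum + h.toNat ≠ k → f ν = 0) → μ.sum ≠ k → Taux q z μ h f = 0 := by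
  induction μ with
  | nil =>
    intro h k f hf hk
    cases h
    · simp only [Taux]; apply hf; simpa using hk
    · simp [Taux]
  | cons b μ ih =>
    intro h k f hf hk
    simp only [List.sum_cons] at hk
    -- auxiliary vanishing
    have key : ∀ (h' : Bool) (b' : ℕ), b' + h.toNat = b + h'.toNat →
        Taux q z μ h' (fun ν => f (b' :: ν)) = 0 := by
      intro h' b' hb
      by_cases hbk : b ≤ k
      · refine ih h' (k - b) _ ?_ (by omega)
        intro ν hν
        apply hf
        simp only [List.sum_cons]
        omega
      · have : (fun ν => f (b' :: ν)) = fun _ => (0 : F) := by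
          funext ν
          apply hf
          simp only [List.sum_cons]
          omega
        rw [this, Taux_zero]
    cases h
    · simp only [Taux]
      rw [key false b (by simp), key true (b+1) (by simp)]; simp
    · cases b with
      | zero => simp only [Taux]; rw [key true 0 (by simp)]; simp
      | succ b =>
        simp only [Taux]
        rw [key true (b+1) (by simp), key false b (by simp)]; simp

lemma SuppOn.T0 {q z : F} {k : ℕ} {f : List ℕ → F} (hf : SuppOn k f) :
    SuppOn k (TL q z false f) := by
  intro μ hμ
  exact Taux_supp q z μ false k f (fun ν hν => hf ν (by simpa using hν)) hμ

lemma SuppOn.T1 {q z : F} {k : ℕ} {f : List ℕ → F} (hf : SuppOn k f) :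
    SuppOn (k + 1) (TL q z true f) := by
  intro μ hμ
  exact Taux_supp q z μ true (k + 1) f (fun ν hν => hf ν (by simpa using hν)) hμ

lemma SuppOn.add {k : ℕ} {f g : List ℕ → F} (hf : SuppOn k f) (hg : SuppOn k g) :
    SuppOn k (f + g) := by
  intro μ hμ; simp [hf μ hμ, hg μ hμ]

lemma SuppOn.smul {k : ℕ} {f : List ℕ → F} (a : F) (hf : SuppOn k f) :
    SuppOn k (a • f) := by
  intro μ hμ; simp [hf μ hμ]

/-- one, two, three exits -/
def P1 (q z : F) : List ℕ → F := TL q z true del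
/-- two exits -/
def P2 (q z w : F) : List ℕ → F := TL q z true (P1 q w)
/-- three exits -/
def P3 (q z w v : F) : List ℕ → F := TL q z true (P2 q w v)

lemma P2_comm (q z w : F) : P2 q z w = P2 q w z := TL_comm1 q z w del
lemma P3_comm12 (q z w v : F) : P3 q z w v = P3 q w z v := TL_comm1 q z w _
lemma P3_comm23 (q z w v : F) : P3 q z w v = P3 q z v w := by
  unfold P3; rw [P2_comm]

lemma T0_P1 (q : F) {z w : F} (h : w ≠ z) :
    TL q z false (P1 q w) = al q z w • P1 q w + be q z w • P1 q z := by
  unfold P1; rw [TL_exch q h, TL_del, TL_del]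

lemma T0_P2 (q : F) {z w v : F} (hw : w ≠ z) (hv : v ≠ z) (hwv : w ≠ v) :
    TL q z false (P2 q w v) = (al q z w * al q z v) • P2 q w v
      + (be q z w * al q w v) • P2 q z v + (be q z v * al q v w) • P2 q w z := by
  have e : TL q z false (P2 q w v) = (al q z w * al q z v) • P2 q w v
      + (al q z w * be q z v + be q z w * be q w v) • P2 q w z
      + (be q z w * al q w v) • P2 q z v := by
    change TL q z false (TL q w true (P1 q v)) = _
    rw [TL_exch q hw, T0_P1 q hv, T0_P1 q hwv.symm]
    simp only [map_add, map_smul]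
    change al q z w • (al q z v • P2 q w v + be q z v • P2 q w z) +
      be q z w • (al q w v • P2 q z v + be q w v • P2 q z w) = _
    rw [P2_comm q z w]
    module
  have e2 : al q z w * be q z v + be q z w * be q w v = be q z v * al q v w := by
    unfold al be
    have h1 := sub_ne_zero.mpr hw
    have h2 := sub_ne_zero.mpr hv
    have h3 := sub_ne_zero.mpr hwv
    have h4 := sub_ne_zero.mpr hwv.symm
    field_simp
    ring
  rw [e, e2]; module

end helpers
section evalHL

variable {F : Type} [Field F]

lemma P1_0 (q z : F) (μ : List ℕ) : P1 q z (0 :: μ) = z * P1 q z μ := rfl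

lemma P1_1 (q z : F) (μ : List ℕ) : P1 q z (1 :: μ) = z * del μ := by
  change z * Taux q z μ true (fun ν => (0 : F)) + z * TL q z false del μ = _
  rw [TL_del, Taux_zero]; ring

lemma P1_2 (q z : F) (b : ℕ) (μ : List ℕ) : P1 q z ((b + 2) :: μ) = 0 := by
  change z * Taux q z μ true (fun ν => (0 : F)) + z * Taux q z μ false (fun ν => (0 : F)) = _
  rw [Taux_zero, Taux_zero]; ring

lemma P2_0 (q z w : F) (μ : List ℕ) : P2 q z w (0 :: μ) = z * w * P2 q z w μ := by
  change z * Taux q z μ true (fun ν => w * P1 q w ν) = _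
  rw [Taux_smul, ← TL_apply, ← P2]; ring

lemma P2_1 (q : F) {z w : F} (hzw : z ≠ w) (μ : List ℕ) : P2 q z w (1 :: μ) =
    z * w * (al q w z * P1 q z μ + al q z w * P1 q w μ) := by
  change z * Taux q z μ true (fun ν => P1 q w (1 :: ν)) +
    z * Taux q z μ false (fun ν => P1 q w (0 :: ν)) = _
  simp only [P1_0, P1_1]
  rw [Taux_smul, ← TL_apply, ← P1, Taux_smul, ← TL_apply, T0_P1 q hzw.symm]
  simp only [Pi.add_apply, Pi.smul_apply, smul_eq_mul]
  have h1 := sub_ne_zero.mpr hzw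
  have h2 := sub_ne_zero.mpr hzw.symm
  have : 1 + be q z w = al q w z := by
    unfold al be; field_simp; ring
  rw [← this]; ring

lemma P2_2 (q z w : F) (μ : List ℕ) : P2 q z w (2 :: μ) = z * w * del μ := by
  change z * Taux q z μ true (fun ν => P1 q w (2 :: ν)) +
    z * Taux q z μ false (fun ν => P1 q w (1 :: ν)) = _
  have := P1_2 q w 0
  simp only [zero_add] at this
  simp only [P1_1, this]
  rw [Taux_zero, Taux_smul, ← TL_apply, TL_del]; ring

lemma P2_3 (q z w : F) (μ : List ℕ) : P2 q z w (3 :: μ) = 0 := by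
  change z * Taux q z μ true (fun ν => P1 q w (3 :: ν)) +
    z * Taux q z μ false (fun ν => P1 q w (2 :: ν)) = _
  have h2 := P1_2 q w 0
  have h3 := P1_2 q w 1
  simp only [zero_add] at h2
  simp only [Nat.reduceAdd] at h3
  simp only [h2, h3, Taux_zero]; ring

lemma P3_0 (q z w v : F) (μ : List ℕ) :
    P3 q z w v (0 :: μ) = z * w * v * P3 q z w v μ := by
  change z * Taux q z μ true (fun ν => P2 q w v (0 :: ν)) = _
  simp only [P2_0]
  rw [Taux_smul, ← TL_apply, ← P3]; ring

lemma P3_1 (q : F) {z w v : F} (h1 : z ≠ w) (h2 : z ≠ v) (h3 : w ≠ v) (μ : List ℕ) :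
    P3 q z w v (1 :: μ) = z * w * v * (al q v z * al q v w * P2 q z w μ
      + al q w z * al q w v * P2 q z v μ + al q z w * al q z v * P2 q w v μ) := by
  change z * Taux q z μ true (fun ν => P2 q w v (1 :: ν)) +
    z * Taux q z μ false (fun ν => P2 q w v (0 :: ν)) = _
  simp only [P2_0, P2_1 q h3]
  rw [Taux_smul, Taux_smul, Taux_add, Taux_smul, Taux_smul,
    ← TL_apply, ← TL_apply, ← TL_apply, ← P2, ← P2, T0_P2 q h1.symm h2.symm h3]
  simp only [Pi.add_apply, Pi.smul_apply, smul_eq_mul]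
  rw [P2_comm q w z]
  have d1 := sub_ne_zero.mpr h1
  have d2 := sub_ne_zero.mpr h1.symm
  have d3 := sub_ne_zero.mpr h2
  have d4 := sub_ne_zero.mpr h2.symm
  have d5 := sub_ne_zero.mpr h3
  have d6 := sub_ne_zero.mpr h3.symm
  have e1 : al q v w + be q z v * al q v w = al q v z * al q v w := by
    unfold al be; field_simp; ring
  have e2 : al q w v + be q z w * al q w v = al q w z * al q w v := by
    unfold al be; field_simp; ring
  rw [← e1, ← e2]; ring

lemma P3_2 (q : F) {z w v : F} (h1 : z ≠ w) (h2 : z ≠ v) (h3 : w ≠ v) (μ : List ℕ) :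
    P3 q z w v (2 :: μ) = z * w * v * (al q w z * al q v z * P1 q z μ
      + al q z w * al q v w * P1 q w μ + al q z v * al q w v * P1 q v μ) := by
  change z * Taux q z μ true (fun ν => P2 q w v (2 :: ν)) +
    z * Taux q z μ false (fun ν => P2 q w v (1 :: ν)) = _
  simp only [P2_2, P2_1 q h3]
  rw [Taux_smul, Taux_smul, Taux_add, Taux_smul, Taux_smul,
    ← TL_apply, ← TL_apply, ← TL_apply, ← P1, T0_P1 q h1.symm, T0_P1 q h2.symm]
  simp only [Pi.add_apply, Pi.smul_apply, smul_eq_mul]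
  have d1 := sub_ne_zero.mpr h1
  have d2 := sub_ne_zero.mpr h1.symm
  have d3 := sub_ne_zero.mpr h2
  have d4 := sub_ne_zero.mpr h2.symm
  have d5 := sub_ne_zero.mpr h3
  have d6 := sub_ne_zero.mpr h3.symm
  have e1 : 1 + al q v w * be q z w + al q w v * be q z v = al q w z * al q v z := by
    unfold al be; field_simp; ring
  rw [← e1]; ring

lemma P3_3 (q z w v : F) (μ : List ℕ) :
    P3 q z w v (3 :: μ) = z * w * v * del μ := by
  change z * Taux q z μ true (fun ν => P2 q w v (3 :: ν)) +
    z * Taux q z μ false (fun ν => P2 q w v (2 :: ν)) = _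
  simp only [P2_2, P2_3]
  rw [Taux_zero, Taux_smul, ← TL_apply, TL_del]; ring

/-- multiplicity lists -/
def M3 (a b c n : ℕ) : List ℕ := List.ofFn (fun i : Fin n =>
  (if a = i.val then 1 else 0) + (if b = i.val then 1 else 0) + (if c = i.val then 1 else 0))
/-- multiplicity lists -/
def M2 (a b n : ℕ) : List ℕ := List.ofFn (fun i : Fin n =>
  (if a = i.val then 1 else 0) + (if b = i.val then 1 else 0))
/-- multiplicity lists -/
def M1 (a n : ℕ) : List ℕ := List.ofFn (fun i : Fin n => if a = i.val then 1 else 0)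
/-- multiplicity lists -/
def M0 (n : ℕ) : List ℕ := List.ofFn (fun _ : Fin n => 0)

lemma M3_s (a b c n : ℕ) : M3 (a+1) (b+1) (c+1) (n+1) = 0 :: M3 a b c n := by
  simp [M3, List.ofFn_succ]
lemma M3_1 (a b n : ℕ) : M3 (a+1) (b+1) 0 (n+1) = 1 :: M2 a b n := by
  simp [M3, M2, List.ofFn_succ]
lemma M3_2 (a n : ℕ) : M3 (a+1) 0 0 (n+1) = 2 :: M1 a n := by
  simp [M3, M1, List.ofFn_succ]
lemma M3_3 (n : ℕ) : M3 0 0 0 (n+1) = 3 :: M0 n := by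
  simp [M3, M0, List.ofFn_succ]
lemma M2_s (a b n : ℕ) : M2 (a+1) (b+1) (n+1) = 0 :: M2 a b n := by
  simp [M2, List.ofFn_succ]
lemma M2_1 (a n : ℕ) : M2 (a+1) 0 (n+1) = 1 :: M1 a n := by
  simp [M2, M1, List.ofFn_succ]
lemma M2_2 (n : ℕ) : M2 0 0 (n+1) = 2 :: M0 n := by
  simp [M2, M0, List.ofFn_succ]
lemma M1_s (a n : ℕ) : M1 (a+1) (n+1) = 0 :: M1 a n := by
  simp [M1, List.ofFn_succ]
lemma M1_1 (n : ℕ) : M1 0 (n+1) = 1 :: M0 n := by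
  simp [M1, M0, List.ofFn_succ]
lemma M0_s (n : ℕ) : M0 (n+1) = 0 :: M0 n := by
  simp [M0, List.ofFn_succ]

lemma del_M0 (n : ℕ) : (del (M0 n) : F) = 1 := by
  induction n with
  | zero => rfl
  | succ n ih => rw [M0_s]; exact ih

lemma P1_eval (q z : F) (a : ℕ) : ∀ n, a < n → P1 q z (M1 a n) = z ^ (a + 1) := by
  induction a with
  | zero =>
    intro n hn
    obtain ⟨n, rfl⟩ := Nat.exists_eq_succ_of_ne_zero (by omega : n ≠ 0)
    rw [Nat.succ_eq_add_one, M1_1, P1_1, del_M0]; ring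
  | succ a ih =>
    intro n hn
    obtain ⟨n, rfl⟩ := Nat.exists_eq_succ_of_ne_zero (by omega : n ≠ 0)
    rw [Nat.succ_eq_add_one, M1_s, P1_0, ih n (by omega)]; ring

lemma P2_eval (q : F) {z w : F} (hzw : z ≠ w) (b : ℕ) : ∀ a n, b ≤ a → a < n →
    P2 q z w (M2 a b n) * (if a = b then 1 + q else 1)
      = z * w * (z ^ a * w ^ b * al q w z + w ^ a * z ^ b * al q z w) := by
  have d1 := sub_ne_zero.mpr hzw
  have d2 := sub_ne_zero.mpr hzw.symm
  induction b with
  | zero =>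
    intro a n hb hn
    obtain ⟨n, rfl⟩ := Nat.exists_eq_succ_of_ne_zero (by omega : n ≠ 0)
    rcases a with _ | a
    · rw [Nat.succ_eq_add_one, M2_2, P2_2, del_M0]
      simp only [if_true]
      unfold al
      field_simp
      ring
    · rw [Nat.succ_eq_add_one, M2_1, P2_1 q hzw, P1_eval _ _ _ _ (by omega),
        P1_eval _ _ _ _ (by omega), if_neg (by omega)]
      ring
  | succ b ih =>
    intro a n hb hn
    obtain ⟨n, rfl⟩ := Nat.exists_eq_succ_of_ne_zero (by omega : n ≠ 0)
    obtain ⟨a, rfl⟩ := Nat.exists_eq_succ_of_ne_zero (by omega : a ≠ 0)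
    have := ih a n (by omega) (by omega)
    simp only [Nat.succ_eq_add_one, M2_s, P2_0, add_left_inj]
    linear_combination z * w * this

/-- Hall--Littlewood symmetrization, six terms. -/
def HL (q : F) (a b c : ℕ) (z w v : F) : F :=
  z^a * w^b * v^c * (al q w z * al q v z * al q v w) +
  z^a * v^b * w^c * (al q v z * al q w z * al q w v) +
  w^a * z^b * v^c * (al q z w * al q v w * al q v z) +
  w^a * v^b * z^c * (al q v w * al q z w * al q z v) +
  v^a * z^b * w^c * (al q z v * al q w v * al q w z) +
  v^a * w^b * z^c * (al q w v * al q z v * al q z w)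

/-- normalisation -/
def cgen (q : F) (a b c : ℕ) : F :=
  if a = b ∧ b = c then (1 + q) * (1 + q + q ^ 2)
  else if a = b ∨ b = c then 1 + q
  else 1

lemma P3_eval (q : F) {z w v : F} (h1 : z ≠ w) (h2 : z ≠ v) (h3 : w ≠ v) (c : ℕ) :
    ∀ a b n, c ≤ b → b ≤ a → a < n →
    P3 q z w v (M3 a b c n) * cgen q a b c = z * w * v * HL q a b c z w v := by
  have d1 := sub_ne_zero.mpr h1
  have d2 := sub_ne_zero.mpr h1.symm
  have d3 := sub_ne_zero.mpr h2
  have d4 := sub_ne_zero.mpr h2.symm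
  have d5 := sub_ne_zero.mpr h3
  have d6 := sub_ne_zero.mpr h3.symm
  induction c with
  | zero =>
    intro a b n hc hb hn
    obtain ⟨n, rfl⟩ := Nat.exists_eq_succ_of_ne_zero (by omega : n ≠ 0)
    rcases b with _ | b
    · rcases a with _ | a
      · rw [Nat.succ_eq_add_one, M3_3, P3_3, del_M0]
        simp only [cgen, HL, and_self, if_true]
        unfold al
        field_simp
        ring
      · rw [Nat.succ_eq_add_one, M3_2, P3_2 q h1 h2 h3]
        rw [P1_eval _ _ _ _ (by omega), P1_eval _ _ _ _ (by omega), P1_eval _ _ _ _ (by omega)]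
        have e1 : al q w v + al q v w = 1 + q := by unfold al; field_simp; ring
        have e2 : al q z v + al q v z = 1 + q := by unfold al; field_simp; ring
        have e3 : al q z w + al q w z = 1 + q := by unfold al; field_simp; ring
        simp only [cgen, HL]
        rw [if_neg (by omega), if_pos (Or.inr trivial)]
        linear_combination (-z*w*v) * (z^(a+1) * al q w z * al q v z * e1
          + w^(a+1) * al q z w * al q v w * e2 + v^(a+1) * al q z v * al q w v * e3)
    · obtain ⟨a, rfl⟩ := Nat.exists_eq_succ_of_ne_zero (by omega : a ≠ 0)
      rw [Nat.succ_eq_add_one, Nat.succ_eq_add_one, M3_1, P3_1 q h1 h2 h3]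
      have E1 := P2_eval q h1 b a n (by omega) (by omega)
      have E2 := P2_eval q h2 b a n (by omega) (by omega)
      have E3 := P2_eval q h3 b a n (by omega) (by omega)
      have ec : cgen q (a+1) (b+1) 0 = if a = b then 1 + q else 1 := by
        simp [cgen]
      rw [ec]
      simp only [HL]
      linear_combination (z*w*v) * (al q v z * al q v w * E1
          + al q w z * al q w v * E2 + al q z w * al q z v * E3)
  | succ c ih =>
    intro a b n hc hb hn
    obtain ⟨n, rfl⟩ := Nat.exists_eq_succ_of_ne_zero (by omega : n ≠ 0)
    obtain ⟨a, rfl⟩ := Nat.exists_eq_succ_of_ne_zero (by omega : a ≠ 0)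
    obtain ⟨b, rfl⟩ := Nat.exists_eq_succ_of_ne_zero (by omega : b ≠ 0)
    have := ih a b n (by omega) (by omega) (by omega)
    have ec : cgen q (a+1) (b+1) (c+1) = cgen q a b c := by
      simp [cgen]
    have eh : HL q (a+1) (b+1) (c+1) z w v = z * w * v * HL q a b c z w v := by
      simp only [HL]; ring
    simp only [Nat.succ_eq_add_one, M3_s, P3_0, ec, eh]
    linear_combination z * w * v * this

end evalHL
section combine

variable {F : Type} [Field F]

/-- bend operator -/
def Kop (q x y A B C D : F) (f : List ℕ → F) : List ℕ → F :=
  A • TL q y false (TL q x false f) + C • TL q y false (TL q x true f)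
    + B • TL q y true (TL q x false f) + D • TL q y true (TL q x true f)

/-- one-exit part of the bend operator -/
def Oop (q x y B C : F) (f : List ℕ → F) : List ℕ → F :=
  C • TL q y false (TL q x true f) + B • TL q y true (TL q x false f)

lemma Oop_eq (q : F) {x y : F} (hxy : x ≠ y) (B C : F) (f : List ℕ → F) :
    Oop q x y B C f = (C * al q y x) • TL q x true (TL q y false f)
      + (C * be q y x + B) • TL q y true (TL q x false f) := by
  unfold Oop
  rw [TL_exch q hxy]
  module

lemma Oop_add (q x y B C : F) (f g : List ℕ → F) :
    Oop q x y B C (f + g) = Oop q x y B C f + Oop q x y B C g := by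
  unfold Oop; simp only [map_add]; module

lemma Oop_smul (q x y B C a : F) (f : List ℕ → F) :
    Oop q x y B C (a • f) = a • Oop q x y B C f := by
  unfold Oop; simp only [map_smul]; module

lemma Oop_del (q : F) {x y : F} (hxy : x ≠ y) (B C : F) :
    Oop q x y B C del = (C * al q y x) • P1 q x + (C * be q y x + B) • P1 q y := by
  rw [Oop_eq q hxy, TL_del, TL_del]; rfl

lemma Oop_P1 (q : F) {x y w k l : F} (hxy : x ≠ y) (hwx : w ≠ x) (hwy : w ≠ y) (B C : F)
    (hk : C * al q y x = k) (hl : C * be q y x + B = l) :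
    Oop q x y B C (P1 q w) = (k * al q y w) • P2 q x w + (l * al q x w) • P2 q y w
      + (k * be q y w + l * be q x w) • P2 q x y := by
  rw [Oop_eq q hxy, T0_P1 q hwx, T0_P1 q hwy, hk, hl]
  simp only [map_add, map_smul]
  change k • (al q y w • P2 q x w + be q y w • P2 q x y)
    + l • (al q x w • P2 q y w + be q x w • P2 q y x) = _
  rw [P2_comm q y x]
  module

lemma Oop_P2 (q : F) {x y w v k l : F} (hxy : x ≠ y) (hwx : w ≠ x) (hwy : w ≠ y)
    (hvx : v ≠ x) (hvy : v ≠ y) (hwv : w ≠ v) (B C : F)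
    (hk : C * al q y x = k) (hl : C * be q y x + B = l) :
    Oop q x y B C (P2 q w v) = (k * (al q y w * al q y v)) • P3 q x w v
      + (l * (al q x w * al q x v)) • P3 q y w v
      + ((k * be q y w + l * be q x w) * al q w v) • P3 q x y v
      + ((k * be q y v + l * be q x v) * al q v w) • P3 q x y w := by
  rw [Oop_eq q hxy, T0_P2 q hwx hvx hwv, T0_P2 q hwy hvy hwv, hk, hl]
  simp only [map_add, map_smul]
  change k • ((al q y w * al q y v) • P3 q x w v + (be q y w * al q w v) • P3 q x y v
      + (be q y v * al q v w) • P3 q x w y)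
    + l • ((al q x w * al q x v) • P3 q y w v + (be q x w * al q w v) • P3 q y x v
      + (be q x v * al q v w) • P3 q y w x) = _
  rw [P3_comm23 q x w y, P3_comm23 q y w x, P3_comm12 q y x w, P3_comm12 q y x v]
  module

lemma T00_P1 (q : F) {x y w : F} (hxy : x ≠ y) (hwx : w ≠ x) (hwy : w ≠ y) :
    TL q y false (TL q x false (P1 q w)) = (al q x w * al q y w) • P1 q w
      + (be q x w * al q y x) • P1 q x + (be q y w * al q x y) • P1 q y := by
  rw [T0_P1 q hwx]
  simp only [map_add, map_smul]
  rw [T0_P1 q hwy, T0_P1 q hxy]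
  have h1 := sub_ne_zero.mpr hxy
  have h2 := sub_ne_zero.mpr hxy.symm
  have h3 := sub_ne_zero.mpr hwx
  have h4 := sub_ne_zero.mpr hwy
  have e : be q y w * al q x y = al q x w * be q y w + be q x w * be q y x := by
    unfold al be; field_simp; ring
  rw [e]; module

theorem combine_main (q : F) (x1 y1 x2 y2 x3 y3 : F)
    (hd : [x1, y1, x2, y2, x3, y3].Nodup)
    (B1 C1 D1 A2 B2 C2 D2 A3 B3 C3 k1 l1 k2 l2 k3 l3 : F)
    (hk1 : C1 * al q y1 x1 = k1) (hl1 : C1 * be q y1 x1 + B1 = l1)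
    (hk2 : C2 * al q y2 x2 = k2) (hl2 : C2 * be q y2 x2 + B2 = l2)
    (hk3 : C3 * al q y3 x3 = k3) (hl3 : C3 * be q y3 x3 + B3 = l3)
    (I23 : D2 * A3 + k3 * (k2 * be q y2 x3 + l2 * be q x2 x3)
      + l3 * (k2 * be q y2 y3 + l2 * be q x2 y3) = 0)
    (I12 : D1 * A2 + k2 * (k1 * be q y1 x2 + l1 * be q x1 x2)
      + l2 * (k1 * be q y1 y2 + l1 * be q x1 y2) = 0)
    (Jx : D1 * A3 * k2 + D1 * A2 * (k3 * be q x2 x3 + l3 * be q x2 y3) * al q y2 x2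
      + k2 * (k3 * al q y2 x3 * al q x3 x2 * (k1 * be q y1 x3 + l1 * be q x1 x3)
        + l3 * al q y2 y3 * al q y3 x2 * (k1 * be q y1 y3 + l1 * be q x1 y3)) = 0)
    (Jy : D1 * A3 * l2 + D1 * A2 * (k3 * be q y2 x3 + l3 * be q y2 y3) * al q x2 y2
      + l2 * (k3 * al q x2 x3 * al q x3 y2 * (k1 * be q y1 x3 + l1 * be q x1 x3)
        + l3 * al q x2 y3 * al q y3 y2 * (k1 * be q y1 y3 + l1 * be q x1 y3)) = 0)
    (μ : List ℕ) (hμ : μ.sum = 3) :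
    Kop q x1 y1 0 B1 C1 D1 (Kop q x2 y2 A2 B2 C2 D2 (Kop q x3 y3 A3 B3 C3 0 del)) μ
    = k1 * k2 * k3 * (al q y1 x2 * al q y1 x3 * al q y2 x3) * P3 q x1 x2 x3 μ
    + k1 * k2 * l3 * (al q y1 x2 * al q y1 y3 * al q y2 y3) * P3 q x1 x2 y3 μ
    + k1 * l2 * k3 * (al q y1 y2 * al q y1 x3 * al q x2 x3) * P3 q x1 y2 x3 μ
    + k1 * l2 * l3 * (al q y1 y2 * al q y1 y3 * al q x2 y3) * P3 q x1 y2 y3 μ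
    + l1 * k2 * k3 * (al q x1 x2 * al q x1 x3 * al q y2 x3) * P3 q y1 x2 x3 μ
    + l1 * k2 * l3 * (al q x1 x2 * al q x1 y3 * al q y2 y3) * P3 q y1 x2 y3 μ
    + l1 * l2 * k3 * (al q x1 y2 * al q x1 x3 * al q x2 x3) * P3 q y1 y2 x3 μ
    + l1 * l2 * l3 * (al q x1 y2 * al q x1 y3 * al q x2 y3) * P3 q y1 y2 y3 μ := by
  simp only [List.nodup_cons, List.mem_cons, List.not_mem_nil, or_false, not_or] at hd
  obtain ⟨⟨n1, n2, n3, n4, n5⟩, ⟨n6, n7, n8, n9⟩, ⟨n10, n11, n12⟩, ⟨n13, n14⟩, n15, -⟩ := hd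
  set E : List ℕ → F := k3 • P1 q x3 + l3 • P1 q y3 with hE
  have sE : SuppOn 1 E := (SuppOn_del.T1.smul _).add (SuppOn_del.T1.smul _)
  have e3 : Kop q x3 y3 A3 B3 C3 0 del = A3 • del + E := by
    have := Oop_del q n15 B3 C3
    rw [hk3, hl3] at this
    rw [hE, ← this]
    unfold Kop Oop
    rw [TL_del, TL_del]; module
  -- graded pieces
  set g1 : List ℕ → F := A2 • TL q y2 false (TL q x2 false E) + A3 • Oop q x2 y2 B2 C2 del
    with hg1
  set g2 : List ℕ → F := Oop q x2 y2 B2 C2 E + (D2 * A3) • P2 q y2 x2 with hg2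
  have sO : ∀ (x y B C : F) (k : ℕ) (f : List ℕ → F), SuppOn k f →
      SuppOn (k + 1) (Oop q x y B C f) := fun x y B C k f hf =>
    (hf.T1.T0.smul _).add (hf.T0.T1.smul _)
  have sg1 : SuppOn 1 g1 := (sE.T0.T0.smul _).add ((sO _ _ _ _ _ _ SuppOn_del).smul _)
  have sg2 : SuppOn 2 g2 := (sO _ _ _ _ _ _ sE).add (SuppOn_del.T1.T1.smul _)
  have e2 : Kop q x2 y2 A2 B2 C2 D2 (A3 • del + E)
      = (A2 * A3) • del + g1 + g2 + D2 • TL q y2 true (TL q x2 true E) := by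
    rw [hg1, hg2]
    have t : TL q y2 true (TL q x2 true (del : List ℕ → F)) = P2 q y2 x2 := rfl
    unfold Kop Oop
    simp only [map_add, map_smul, TL_del, t]
    module
  have s3 : SuppOn 3 (TL q y2 true (TL q x2 true E)) := sE.T1.T1
  have e1 : Kop q x1 y1 0 B1 C1 D1 (Kop q x2 y2 A2 B2 C2 D2 (Kop q x3 y3 A3 B3 C3 0 del)) μ
      = Oop q x1 y1 B1 C1 g2 μ + D1 * TL q x1 true (TL q y1 true g1) μ := by
    rw [e3, e2, TL_comm1 q x1 y1]
    have : ∀ f, Kop q x1 y1 0 B1 C1 D1 f = Oop q x1 y1 B1 C1 f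
        + D1 • TL q y1 true (TL q x1 true f) := by
      intro f; unfold Kop Oop; module
    rw [this]
    simp only [Oop_add, Oop_smul, map_add, map_smul, Pi.add_apply, Pi.smul_apply, smul_eq_mul]
    rw [sO x1 y1 B1 C1 0 del SuppOn_del μ (by omega), sO x1 y1 B1 C1 1 g1 sg1 μ (by omega),
      sO x1 y1 B1 C1 3 _ s3 μ (by omega), s3.T1.T1 μ (by omega), sg2.T1.T1 μ (by omega),
      SuppOn_del.T1.T1 μ (by omega)]
    ring
  have f2 : g2 = (k3 * (k2 * al q y2 x3)) • P2 q x2 x3 + (k3 * (l2 * al q x2 x3)) • P2 q y2 x3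
      + (l3 * (k2 * al q y2 y3)) • P2 q x2 y3 + (l3 * (l2 * al q x2 y3)) • P2 q y2 y3 := by
    rw [hg2, hE, Oop_add, Oop_smul, Oop_smul,
      Oop_P1 q n10 (Ne.symm n11) (Ne.symm n13) B2 C2 hk2 hl2,
      Oop_P1 q n10 (Ne.symm n12) (Ne.symm n14) B2 C2 hk2 hl2, P2_comm q y2 x2]
    have : D2 * A3 = -(k3 * (k2 * be q y2 x3 + l2 * be q x2 x3)
      + l3 * (k2 * be q y2 y3 + l2 * be q x2 y3)) := by linear_combination I23
    rw [this]
    module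
  have f1 : TL q x1 true (TL q y1 true g1)
      = (A2 * k3 * (al q x2 x3 * al q y2 x3)) • P3 q x1 y1 x3
      + (A2 * l3 * (al q x2 y3 * al q y2 y3)) • P3 q x1 y1 y3
      + (A2 * (k3 * be q x2 x3 + l3 * be q x2 y3) * al q y2 x2 + A3 * k2) • P3 q x1 y1 x2
      + (A2 * (k3 * be q y2 x3 + l3 * be q y2 y3) * al q x2 y2 + A3 * l2) • P3 q x1 y1 y2 := by
    rw [hg1, hE]
    simp only [map_add, map_smul]
    rw [T00_P1 q n10 (Ne.symm n11) (Ne.symm n13), T00_P1 q n10 (Ne.symm n12) (Ne.symm n14),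
      Oop_del q n10, hk2, hl2]
    simp only [map_add, map_smul]
    have t : ∀ w, TL q x1 true (TL q y1 true (P1 q w)) = P3 q x1 y1 w := fun _ => rfl
    simp only [t]
    module
  rw [e1, f1, f2]
  simp only [Oop_add, Oop_smul]
  rw [Oop_P2 q n1 (Ne.symm n2) (Ne.symm n6) (Ne.symm n4) (Ne.symm n8) n11 B1 C1 hk1 hl1,
    Oop_P2 q n1 (Ne.symm n3) (Ne.symm n7) (Ne.symm n4) (Ne.symm n8) n13 B1 C1 hk1 hl1,
    Oop_P2 q n1 (Ne.symm n2) (Ne.symm n6) (Ne.symm n5) (Ne.symm n9) n12 B1 C1 hk1 hl1,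
    Oop_P2 q n1 (Ne.symm n3) (Ne.symm n7) (Ne.symm n5) (Ne.symm n9) n14 B1 C1 hk1 hl1]
  simp only [Pi.add_apply, Pi.smul_apply, smul_eq_mul]
  linear_combination (k3 * al q y2 x3 * al q x2 x3 * P3 q x1 y1 x3 μ
      + l3 * al q y2 y3 * al q x2 y3 * P3 q x1 y1 y3 μ) * I12
    + P3 q x1 y1 x2 μ * Jx + P3 q x1 y1 y2 μ * Jy

end combine
section identities

variable {F : Type} [Field F]

/-- genericity of a pair -/
lemma S1 (q : F) {x w : F} (hx : x ≠ 0) (hxx : x ^ 2 ≠ 1) (h1 : w ≠ x) (h2 : w * x ≠ 1) :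
    al q x⁻¹ x * be q x⁻¹ w + al q x x⁻¹ * be q x w
      = -((1 - q) * w * ((1 + q) * w * x - (x ^ 2 + 1)) / ((w - x) * (w * x - 1))) := by
  have d1 : w - x ≠ 0 := sub_ne_zero.mpr h1
  have d2 : w * x - 1 ≠ 0 := sub_ne_zero.mpr h2
  have d2' : x * w - 1 ≠ 0 := by rwa [mul_comm x w]
  have d3 : x ^ 2 - 1 ≠ 0 := sub_ne_zero.mpr hxx
  have d4 : 1 - x ^ 2 ≠ 0 := sub_ne_zero.mpr hxx.symm
  have a1 : al q x⁻¹ x = (x ^ 2 - q) / (x ^ 2 - 1) := by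
    unfold al
    rw [show x - x⁻¹ = (x ^ 2 - 1) / x by field_simp]; field_simp
  have a2 : al q x x⁻¹ = (1 - q * x ^ 2) / (1 - x ^ 2) := by
    unfold al
    rw [show x⁻¹ - x = (1 - x ^ 2) / x by field_simp]; field_simp
  have a3 : be q x⁻¹ w = -((1 - q) * w * x / (w * x - 1)) := by
    unfold be
    rw [show w - x⁻¹ = (w * x - 1) / x by field_simp]; field_simp
  have a4 : be q x w = -((1 - q) * w / (w - x)) := rfl
  rw [a1, a2, a3, a4]
  rw [show 1 - x ^ 2 = -(x ^ 2 - 1) by ring]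
  field_simp
  ring

lemma S2 (q : F) {x w : F} (hx : x ≠ 0) (hxx : x ^ 2 ≠ 1) (h1 : w ≠ x) (h2 : w * x ≠ 1) :
    x⁻¹ * al q x⁻¹ x * be q x⁻¹ w + x * al q x x⁻¹ * be q x w
      = -((1 - q) * w * (q * w * (x ^ 2 + 1) - (q + 1) * x) / ((w - x) * (w * x - 1))) := by
  have d1 : w - x ≠ 0 := sub_ne_zero.mpr h1
  have d2 : w * x - 1 ≠ 0 := sub_ne_zero.mpr h2
  have d2' : x * w - 1 ≠ 0 := by rwa [mul_comm x w]
  have d3 : x ^ 2 - 1 ≠ 0 := sub_ne_zero.mpr hxx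
  have a1 : al q x⁻¹ x = (x ^ 2 - q) / (x ^ 2 - 1) := by
    unfold al
    rw [show x - x⁻¹ = (x ^ 2 - 1) / x by field_simp]; field_simp
  have a2 : al q x x⁻¹ = (1 - q * x ^ 2) / (1 - x ^ 2) := by
    have d4 : 1 - x ^ 2 ≠ 0 := sub_ne_zero.mpr hxx.symm
    unfold al
    rw [show x⁻¹ - x = (1 - x ^ 2) / x by field_simp]; field_simp
  have a3 : be q x⁻¹ w = -((1 - q) * w * x / (w * x - 1)) := by
    unfold be
    rw [show w - x⁻¹ = (w * x - 1) / x by field_simp]; field_simp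
  have a4 : be q x w = -((1 - q) * w / (w - x)) := rfl
  rw [a1, a2, a3, a4]
  rw [show 1 - x ^ 2 = -(x ^ 2 - 1) by ring]
  field_simp
  ring

lemma al_inv (q : F) {x : F} (hx : x ≠ 0) (hxx : x ^ 2 ≠ 1) :
    al q x⁻¹ x = (x ^ 2 - q) / (x ^ 2 - 1) ∧ al q x x⁻¹ = (q * x ^ 2 - 1) / (x ^ 2 - 1) := by
  have d3 : x ^ 2 - 1 ≠ 0 := sub_ne_zero.mpr hxx
  constructor
  · unfold al
    rw [show x - x⁻¹ = (x ^ 2 - 1) / x by field_simp]; field_simp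
  · unfold al
    rw [show x⁻¹ - x = -((x ^ 2 - 1) / x) by field_simp; ring]; field_simp; ring

lemma inv_gen {x u : F} (hx : x ≠ 0) (hu : u ≠ 0) (h1 : u ≠ x) (h2 : u * x ≠ 1) :
    u⁻¹ ≠ x ∧ u⁻¹ * x ≠ 1 := by
  constructor
  · intro h; apply h2; rw [← h]; field_simp
  · intro h; apply h1; field_simp at h; exact h.symm

lemma idI1 (q : F) {x u : F} (hx : x ≠ 0) (hu : u ≠ 0) (hxx : x ^ 2 ≠ 1) (huu : u ^ 2 ≠ 1)
    (h1 : u ≠ x) (h2 : u * x ≠ 1) :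
    (1 - q ^ 2) + al q u⁻¹ u * (al q x⁻¹ x * be q x⁻¹ u + al q x x⁻¹ * be q x u)
      + al q u u⁻¹ * (al q x⁻¹ x * be q x⁻¹ u⁻¹ + al q x x⁻¹ * be q x u⁻¹) = 0 := by
  obtain ⟨h3, h4⟩ := inv_gen hx hu h1 h2
  rw [S1 q hx hxx h1 h2, S1 q hx hxx h3 h4, (al_inv q hu huu).1, (al_inv q hu huu).2]
  have d1 : u - x ≠ 0 := sub_ne_zero.mpr h1
  have d2 : u * x - 1 ≠ 0 := sub_ne_zero.mpr h2
  have d2' : x * u - 1 ≠ 0 := by rwa [mul_comm x u]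
  have d3 : u ^ 2 - 1 ≠ 0 := sub_ne_zero.mpr huu
  rw [show u⁻¹ - x = -((u * x - 1) / u) by field_simp; ring,
    show u⁻¹ * x - 1 = -((u - x) / u) by field_simp; ring]
  field_simp
  ring

lemma idI2 (q : F) {x u : F} (hx : x ≠ 0) (hu : u ≠ 0) (hxx : x ^ 2 ≠ 1) (huu : u ^ 2 ≠ 1)
    (h1 : u ≠ x) (h2 : u * x ≠ 1) :
    (q ^ 3 - q) + u⁻¹ * al q u⁻¹ u *
        (x⁻¹ * al q x⁻¹ x * be q x⁻¹ u + x * al q x x⁻¹ * be q x u)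
      + u * al q u u⁻¹ *
        (x⁻¹ * al q x⁻¹ x * be q x⁻¹ u⁻¹ + x * al q x x⁻¹ * be q x u⁻¹) = 0 := by
  obtain ⟨h3, h4⟩ := inv_gen hx hu h1 h2
  rw [S2 q hx hxx h1 h2, S2 q hx hxx h3 h4, (al_inv q hu huu).1, (al_inv q hu huu).2]
  have d1 : u - x ≠ 0 := sub_ne_zero.mpr h1
  have d2 : u * x - 1 ≠ 0 := sub_ne_zero.mpr h2
  have d2' : x * u - 1 ≠ 0 := by rwa [mul_comm x u]
  have d3 : u ^ 2 - 1 ≠ 0 := sub_ne_zero.mpr huu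
  rw [show u⁻¹ - x = -((u * x - 1) / u) by field_simp; ring,
    show u⁻¹ * x - 1 = -((u - x) / u) by field_simp; ring]
  field_simp
  ring

lemma alx (q : F) {y u : F} (hy : y ≠ 0) (hu : u ≠ 0) (h1 : u ≠ y) (h2 : u * y ≠ 1) :
    al q y⁻¹ u = (u * y - q) / (u * y - 1) ∧ al q u y = -((y - q * u) / (u - y)) ∧
    al q y⁻¹ u⁻¹ = -((y - q * u) / (u - y)) ∧ al q u⁻¹ y = (u * y - q) / (u * y - 1) ∧
    be q y u = -((1 - q) * u / (u - y)) ∧ be q y u⁻¹ = (1 - q) / (u * y - 1) := by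
  have d1 : u - y ≠ 0 := sub_ne_zero.mpr h1
  have d2 : u * y - 1 ≠ 0 := sub_ne_zero.mpr h2
  have d2' : y * u - 1 ≠ 0 := by rwa [mul_comm y u]
  have e1 : u - y⁻¹ = (u * y - 1) / y := by field_simp
  have e2 : y - u = -(u - y) := by ring
  have e3 : u⁻¹ - y⁻¹ = -((u - y) / (u * y)) := by field_simp; ring
  have e4 : y - u⁻¹ = (u * y - 1) / u := by field_simp
  have e5 : u⁻¹ - y = -((u * y - 1) / u) := by field_simp; ring
  refine ⟨?_, ?_, ?_, ?_, rfl, ?_⟩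
  · unfold al; rw [e1]; field_simp
  · unfold al; rw [e2]; field_simp
  · unfold al; rw [e3]; field_simp
  · unfold al; rw [e4]; field_simp
  · unfold be; rw [e5]; field_simp

lemma idJ1 (q : F) {x y u : F} (hx : x ≠ 0) (hy : y ≠ 0) (hu : u ≠ 0)
    (hxx : x ^ 2 ≠ 1) (huu : u ^ 2 ≠ 1)
    (h1 : u ≠ x) (h2 : u * x ≠ 1) (g1 : u ≠ y) (g2 : u * y ≠ 1) :
    (1 - q ^ 2) * (1 + al q u⁻¹ u * be q y u + al q u u⁻¹ * be q y u⁻¹)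
      + al q u⁻¹ u * al q y⁻¹ u * al q u y *
          (al q x⁻¹ x * be q x⁻¹ u + al q x x⁻¹ * be q x u)
      + al q u u⁻¹ * al q y⁻¹ u⁻¹ * al q u⁻¹ y *
          (al q x⁻¹ x * be q x⁻¹ u⁻¹ + al q x x⁻¹ * be q x u⁻¹) = 0 := by
  obtain ⟨h3, h4⟩ := inv_gen hx hu h1 h2
  obtain ⟨r1, r2, r3, r4, r5, r6⟩ := alx q hy hu g1 g2
  rw [S1 q hx hxx h1 h2, S1 q hx hxx h3 h4, (al_inv q hu huu).1, (al_inv q hu huu).2,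
    r1, r2, r3, r4, r5, r6]
  have d1 : u - x ≠ 0 := sub_ne_zero.mpr h1
  have d2 : u * x - 1 ≠ 0 := sub_ne_zero.mpr h2
  have d2' : x * u - 1 ≠ 0 := by rwa [mul_comm x u]
  have d3 : u ^ 2 - 1 ≠ 0 := sub_ne_zero.mpr huu
  have d4 : u - y ≠ 0 := sub_ne_zero.mpr g1
  have d5 : u * y - 1 ≠ 0 := sub_ne_zero.mpr g2
  have d5' : y * u - 1 ≠ 0 := by rwa [mul_comm y u]
  rw [show u⁻¹ - x = -((u * x - 1) / u) by field_simp; ring,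
    show u⁻¹ * x - 1 = -((u - x) / u) by field_simp; ring]
  field_simp
  ring

lemma idJ2 (q : F) {x y u : F} (hx : x ≠ 0) (hy : y ≠ 0) (hu : u ≠ 0)
    (hxx : x ^ 2 ≠ 1) (huu : u ^ 2 ≠ 1)
    (h1 : u ≠ x) (h2 : u * x ≠ 1) (g1 : u ≠ y) (g2 : u * y ≠ 1) :
    (q ^ 5 - q ^ 3) * y⁻¹
      + (q ^ 3 - q) * (u⁻¹ * al q u⁻¹ u * be q y u + u * al q u u⁻¹ * be q y u⁻¹)
      + y⁻¹ * (u⁻¹ * al q u⁻¹ u * al q y⁻¹ u * al q u y *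
          (x⁻¹ * al q x⁻¹ x * be q x⁻¹ u + x * al q x x⁻¹ * be q x u)
      + u * al q u u⁻¹ * al q y⁻¹ u⁻¹ * al q u⁻¹ y *
          (x⁻¹ * al q x⁻¹ x * be q x⁻¹ u⁻¹ + x * al q x x⁻¹ * be q x u⁻¹)) = 0 := by
  obtain ⟨h3, h4⟩ := inv_gen hx hu h1 h2
  obtain ⟨r1, r2, r3, r4, r5, r6⟩ := alx q hy hu g1 g2
  rw [S2 q hx hxx h1 h2, S2 q hx hxx h3 h4, (al_inv q hu huu).1, (al_inv q hu huu).2,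
    r1, r2, r3, r4, r5, r6]
  have d1 : u - x ≠ 0 := sub_ne_zero.mpr h1
  have d2 : u * x - 1 ≠ 0 := sub_ne_zero.mpr h2
  have d2' : x * u - 1 ≠ 0 := by rwa [mul_comm x u]
  have d3 : u ^ 2 - 1 ≠ 0 := sub_ne_zero.mpr huu
  have d4 : u - y ≠ 0 := sub_ne_zero.mpr g1
  have d5 : u * y - 1 ≠ 0 := sub_ne_zero.mpr g2
  have d5' : y * u - 1 ≠ 0 := by rwa [mul_comm y u]
  rw [show u⁻¹ - x = -((u * x - 1) / u) by field_simp; ring,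
    show u⁻¹ * x - 1 = -((u - x) / u) by field_simp; ring]
  field_simp
  ring

end identities
section states

variable {F : Type} [Field F]

/-- the multiplicities above a row -/
def stepm {n : ℕ} (m : Fin n → ℕ) (hh : Fin (n + 1) → Bool) (c : Fin n) : ℕ :=
  m c + (hh c.succ).toNat - (hh c.castSucc).toNat

lemma Taux_cons (q z : F) (b : ℕ) (μ : List ℕ) (h0 : Bool) (f : List ℕ → F) :
    Taux q z (b :: μ) h0 f = ∑ hr : Bool, sixw q z h0 hr (b + hr.toNat - h0.toNat) b *
      Taux q z μ hr (fun ν => f ((b + hr.toNat - h0.toNat) :: ν)) := by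
  rw [Fintype.sum_bool]
  cases h0
  · simp [Taux, sixw]; ring
  · cases b <;> simp [Taux, sixw]

lemma sum_cons_fun {α : Type} [Fintype α] [DecidableEq α] {n : ℕ} (g : (Fin (n + 1) → α) → F) :
    ∑ h, g h = ∑ a : α, ∑ h' : Fin n → α, g (Fin.cons a h') := by
  rw [← (Fin.consEquiv (fun _ : Fin (n + 1) => α)).sum_comp, Fintype.sum_prod_type]
  rfl

lemma Taux_row (q z : F) : ∀ (n : ℕ) (m : Fin n → ℕ) (h0 : Bool) (f : List ℕ → F),
    Taux q z (List.ofFn m) h0 f = ∑ hh : Fin (n + 1) → Bool,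
      if hh 0 = h0 ∧ hh (Fin.last n) = false then
        (∏ c, sixw q z (hh c.castSucc) (hh c.succ) (stepm m hh c) (m c)) *
          f (List.ofFn (stepm m hh)) else 0 := by
  intro n
  induction n with
  | zero =>
    intro m h0 f
    rw [sum_cons_fun]
    cases h0 <;> simp [Taux]
  | succ n ih =>
    intro m h0 f
    rw [List.ofFn_succ, Taux_cons, sum_cons_fun]
    simp only [ih, Finset.mul_sum]
    conv_lhs => rw [Finset.sum_comm]
    conv_rhs => rw [Finset.sum_comm]
    apply Finset.sum_congr rfl
    intro hh _
    rw [Finset.sum_eq_single (hh 0) (by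
          intro b _ hb; rw [if_neg (by intro h; exact hb h.1.symm), mul_zero]) (by simp),
      Finset.sum_eq_single h0 (by
          intro b _ hb; rw [if_neg (by intro h; exact hb (by simpa using h.1))]) (by simp)]
    have hl : (Fin.cons h0 hh : Fin (n + 2) → Bool) (Fin.last (n + 1)) = hh (Fin.last n) := by
      rw [← Fin.succ_last, Fin.cons_succ]
    simp only [hl, Fin.cons_zero, true_and]
    split_ifs with hc
    · rw [Fin.prod_univ_succ, List.ofFn_succ, ← mul_assoc]
      simp only [stepm, Fin.cons_succ, Fin.castSucc_zero, Fin.cons_zero, ← Fin.succ_castSucc]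
      rfl
    · simp

/-- all multiplicities from the horizontal labels -/
def Mfun {n : ℕ} : (N : ℕ) → (Fin N → Fin (n + 1) → Bool) → (Fin n → ℕ) →
    Fin (N + 1) → Fin n → ℕ
  | 0, _, m0 => fun _ => m0
  | N + 1, h, m0 => Fin.cons m0 (Mfun N (Fin.tail h) (stepm m0 (h 0)))

lemma Mfun_zero {n : ℕ} (N : ℕ) (h : Fin N → Fin (n + 1) → Bool) (m0 : Fin n → ℕ) :
    Mfun N h m0 0 = m0 := by
  cases N <;> rfl

lemma Mfun_succ {n : ℕ} : ∀ (N : ℕ) (h : Fin N → Fin (n + 1) → Bool) (m0 : Fin n → ℕ)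
    (s : Fin N), Mfun N h m0 s.succ = stepm (Mfun N h m0 s.castSucc) (h s) := by
  intro N
  induction N with
  | zero => intro h m0 s; exact s.elim0
  | succ N ih =>
    intro h m0 s
    refine Fin.cases ?_ (fun t => ?_) s
    · simp only [Mfun, Fin.cons_succ, Fin.castSucc_zero, Fin.cons_zero, Mfun_zero]
    · simp only [Mfun, Fin.cons_succ, ← Fin.succ_castSucc]
      exact ih _ _ t

/-- iterated row operators applied to the vacuum -/
def iterT (q : F) : (N : ℕ) → (Fin N → F) → (Fin N → Bool) → List ℕ → F
  | 0, _, _ => del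
  | N + 1, z, h0 => TL q (z 0) (h0 0) (iterT q N (Fin.tail z) (Fin.tail h0))

lemma del_ofFn : ∀ (n : ℕ) (m : Fin n → ℕ),
    (del (List.ofFn m) : F) = if ∀ c, m c = 0 then 1 else 0 := by
  intro n
  induction n with
  | zero => intro m; simp [del]
  | succ n ih =>
    intro m
    rw [List.ofFn_succ]
    rcases h : m 0 with _ | k
    · simp only [del, ih, Fin.forall_fin_succ, h, true_and]
    · simp only [del]
      rw [if_neg]
      intro h'
      have := h' 0
      omega

/-- the vertex part of the weight -/
def vw {n : ℕ} (q : F) (N : ℕ) (z : Fin N → F) (h : Fin N → Fin (n + 1) → Bool)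
    (M : Fin (N + 1) → Fin n → ℕ) : F :=
  ∏ s, ∏ c, sixw q (z s) (h s c.castSucc) (h s c.succ) (M s.succ c) (M s.castSucc c)

lemma iterT_eq {n : ℕ} (q : F) : ∀ (N : ℕ) (z : Fin N → F) (h0 : Fin N → Bool)
    (m0 : Fin n → ℕ), iterT q N z h0 (List.ofFn m0) = ∑ h : Fin N → Fin (n + 1) → Bool,
      if (∀ s, h s 0 = h0 s) ∧ (∀ s, h s (Fin.last n) = false) ∧
        (∀ c, Mfun N h m0 (Fin.last N) c = 0) then vw q N z h (Mfun N h m0) else 0 := by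
  intro N
  induction N with
  | zero =>
    intro z h0 m0
    simp [iterT, del_ofFn, Mfun, vw]
  | succ N ih =>
    intro z h0 m0
    rw [sum_cons_fun, iterT, TL_apply, Taux_row]
    apply Finset.sum_congr rfl
    intro hh _
    rw [ih]
    have hM : ∀ h' : Fin N → Fin (n + 1) → Bool,
        Mfun (N + 1) (Fin.cons hh h') m0 = Fin.cons m0 (Mfun N h' (stepm m0 hh)) := by
      intro h'; rfl
    have hlast : ∀ h' : Fin N → Fin (n + 1) → Bool,
        Mfun (N + 1) (Fin.cons hh h') m0 (Fin.last (N + 1))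
          = Mfun N h' (stepm m0 hh) (Fin.last N) := by
      intro h'; rw [hM, ← Fin.succ_last, Fin.cons_succ]
    have hv : ∀ h' : Fin N → Fin (n + 1) → Bool,
        vw q (N + 1) z (Fin.cons hh h') (Mfun (N + 1) (Fin.cons hh h') m0)
          = (∏ c, sixw q (z 0) (hh c.castSucc) (hh c.succ) (stepm m0 hh c) (m0 c))
            * vw q N (Fin.tail z) h' (Mfun N h' (stepm m0 hh)) := by
      intro h'
      rw [hM]
      unfold vw
      rw [Fin.prod_univ_succ]
      simp only [Fin.cons_succ, Fin.castSucc_zero, Fin.cons_zero, ← Fin.succ_castSucc,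
        Mfun_zero, Fin.tail]
    simp only [hlast, hv, Fin.forall_fin_succ, Fin.cons_zero, Fin.cons_succ]
    by_cases hc : hh 0 = h0 0 ∧ hh (Fin.last n) = false
    · rw [if_pos hc, Finset.mul_sum]
      apply Finset.sum_congr rfl
      intro h' _
      simp only [hc.1, hc.2, true_and, Fin.tail]
      split_ifs with hcc
      · congr 1
        exact if_pos hcc
      · refine Eq.trans (congrArg (_ * ·) (if_neg hcc)) (mul_zero _)
    · rw [if_neg hc]
      symm
      apply Finset.sum_eq_zero
      intro h' _
      rw [if_neg]
      rintro ⟨⟨a, -⟩, ⟨b, -⟩, -⟩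
      exact hc ⟨a, b⟩

lemma sixw_ne {q z : F} {hl hr : Bool} {a b : ℕ} (h : sixw q z hl hr a b ≠ 0) :
    a = b + hr.toNat - hl.toNat := by
  cases hl <;> cases hr <;> simp [sixw] at h ⊢ <;> omega

lemma ZBC_eq {r : ℕ} (lam : Fin r → ℕ) (L : ℕ) (q : F) (x A B C D : Fin r → F) :
    ZBC lam L q x A B C D = ∑ h0 : Fin (2 * r) → Bool,
      (∏ i : Fin r, bendw (A i) (B i) (C i) (D i)
        (h0 ⟨2*i.val+1, by have := i.isLt; omega⟩) (h0 ⟨2*i.val, by have := i.isLt; omega⟩)) *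
      iterT q (2 * r) (rowp x) h0 (List.ofFn (fun c : Fin (L + 1) =>
        (Finset.univ.filter (fun i => lam i = c.val)).card)) := by
  classical
  set m0 : Fin (L + 1) → ℕ := fun c => (Finset.univ.filter (fun i => lam i = c.val)).card with hm0
  let p : (Fin (2 * r) → Fin (L + 1 + 1) → Bool) → Prop := fun h =>
    (∀ s, h s (Fin.last (L + 1)) = false) ∧ (∀ c, Mfun (2 * r) h m0 (Fin.last (2 * r)) c = 0)
  let Φ : {h // p h} → BCState r lam L := fun h =>
    { m := Mfun (2 * r) h.1 m0
      h := h.1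
      bottom := fun c => by rw [Mfun_zero]
      top := h.2.2
      right := h.2.1 }
  have hΦ : Function.Injective Φ := by
    intro a b hab
    apply Subtype.ext
    exact congrArg BCState.h hab
  have hsupp : Function.support (fun st : BCState r lam L => stateWeight q x A B C D st)
      ⊆ ↑(Finset.univ.image Φ) := by
    intro st hst
    have hw : stateWeight q x A B C D st ≠ 0 := hst
    unfold stateWeight at hw
    have hw1 := left_ne_zero_of_mul hw
    have hstep : ∀ s, st.m (Fin.succ s) = stepm (st.m s.castSucc) (st.h s) := by
      intro s
      funext c
      have a1 := Finset.prod_ne_zero_iff.mp hw1 s (Finset.mem_univ _)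
      exact sixw_ne (Finset.prod_ne_zero_iff.mp a1 c (Finset.mem_univ _))
    have hm : ∀ s, st.m s = Mfun (2 * r) st.h m0 s := by
      intro s
      induction s using Fin.induction with
      | zero => rw [Mfun_zero]; funext c; exact st.bottom c
      | succ s ih => rw [hstep, Mfun_succ, ih]
    have hm' : Mfun (2 * r) st.h m0 = st.m := (funext hm).symm
    simp only [Finset.coe_image, Finset.coe_univ, Set.image_univ, Set.mem_range]
    refine ⟨⟨st.h, st.right, fun c => by rw [hm']; exact st.top c⟩, ?_⟩
    obtain ⟨m, h, b, t, rr⟩ := st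
    simp only [Φ, BCState.mk.injEq, and_true]
    exact hm'
  unfold ZBC
  rw [finsum_eq_sum_of_support_subset _ hsupp, Finset.sum_image (fun a _ b _ hab => hΦ hab)]
  simp only [iterT_eq, Finset.mul_sum]
  rw [Finset.sum_comm]
  refine (Finset.sum_subtype (Finset.univ.filter p) (by simp)
    (fun h => vw q (2 * r) (rowp x) h (Mfun (2 * r) h m0) * ∏ i : Fin r,
      bendw (A i) (B i) (C i) (D i)
        (h ⟨2*i.val+1, by have := i.isLt; omega⟩ 0)
        (h ⟨2*i.val, by have := i.isLt; omega⟩ 0))).symm.trans ?_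
  rw [Finset.sum_filter]
  apply Finset.sum_congr rfl
  intro h _
  rw [Finset.sum_eq_single (fun s => h s 0)]
  · simp only [implies_true, true_and, mul_ite, mul_zero]
    by_cases hp : p h
    · rw [if_pos hp, if_pos hp, mul_comm]
    · rw [if_neg hp, if_neg hp]
  · intro b _ hb
    rw [if_neg, mul_zero]
    rintro ⟨h1, -⟩
    exact hb (funext fun s => (h1 s).symm)
  · simp

lemma ZBC3_eq (lam : Fin 3 → ℕ) (L : ℕ) (q : F) (x A B C D : Fin 3 → F) :
    ZBC lam L q x A B C D =
      Kop q (x 0) (x 0)⁻¹ (A 0) (B 0) (C 0) (D 0)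
        (Kop q (x 1) (x 1)⁻¹ (A 1) (B 1) (C 1) (D 1)
          (Kop q (x 2) (x 2)⁻¹ (A 2) (B 2) (C 2) (D 2) del)) (List.ofFn (fun c : Fin (L + 1) =>
        (Finset.univ.filter (fun i => lam i = c.val)).card)) := by
  rw [ZBC_eq]
  generalize List.ofFn (fun c : Fin (L + 1) =>
        (Finset.univ.filter (fun i => lam i = c.val)).card) = μ
  have key : ∀ (a0 a1 a2 a3 a4 a5 : Bool),
      iterT q (2 * 3) (rowp x) (![a0, a1, a2, a3, a4, a5] : Fin 6 → Bool)
      = TL q (x 0)⁻¹ a0 (TL q (x 0) a1 (TL q (x 1)⁻¹ a2 (TL q (x 1) a3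
          (TL q (x 2)⁻¹ a4 (TL q (x 2) a5 del))))) := by
    intros; rfl
  have s6 : ∀ g : (Fin 6 → Bool) → F, ∑ h, g h = ∑ a0, ∑ a1, ∑ a2, ∑ a3, ∑ a4, ∑ a5,
      g ![a0, a1, a2, a3, a4, a5] := by
    intro g
    simp only [sum_cons_fun]
    simp
    rfl
  refine (s6 _).trans ?_
  have bd : ∀ (a0 a1 a2 a3 a4 a5 : Bool), (∏ i : Fin 3, bendw (A i) (B i) (C i) (D i)
        ((![a0, a1, a2, a3, a4, a5] : Fin 6 → Bool) ⟨2*i.val+1, by have := i.isLt; omega⟩)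
        ((![a0, a1, a2, a3, a4, a5] : Fin 6 → Bool) ⟨2*i.val, by have := i.isLt; omega⟩))
      = bendw (A 0) (B 0) (C 0) (D 0) a1 a0 * bendw (A 1) (B 1) (C 1) (D 1) a3 a2
        * bendw (A 2) (B 2) (C 2) (D 2) a5 a4 := by
    intros; rw [Fin.prod_univ_three]; rfl
  have hK : ∀ (i : Fin 3) (f : List ℕ → F),
      Kop q (x i) (x i)⁻¹ (A i) (B i) (C i) (D i) f = ∑ a : Bool, ∑ b : Bool,
        bendw (A i) (B i) (C i) (D i) b a • TL q (x i)⁻¹ a (TL q (x i) b f) := by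
    intro i f
    simp only [Fintype.sum_bool, bendw, Kop]
    abel
  simp only [hK, map_sum, map_smul, Finset.sum_apply, Pi.smul_apply, smul_eq_mul, Finset.mul_sum]
  refine Finset.sum_congr rfl fun a0 _ => Finset.sum_congr rfl fun a1 _ =>
    Finset.sum_congr rfl fun a2 _ => Finset.sum_congr rfl fun a3 _ =>
    Finset.sum_congr rfl fun a4 _ => Finset.sum_congr rfl fun a5 _ => ?_
  rw [key]
  refine (congrArg (· * _) (bd a0 a1 a2 a3 a4 a5)).trans ?_
  ring

end states
section final

variable {F : Type} [Field F]

/-- genericity of the variables -/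
structure Gen3 (x : Fin 3 → F) : Prop where
  ne0 : ∀ i, x i ≠ 0
  sq : ∀ i, x i ^ 2 ≠ 1
  ne : ∀ i j, i ≠ j → x i ≠ x j
  mul : ∀ i j, i ≠ j → x i * x j ≠ 1

/-- the symmetric factor -/
def Kf (q u v w : F) : F :=
  al q u⁻¹ v * al q u⁻¹ w * al q v⁻¹ w * (al q u⁻¹ u * al q v⁻¹ v * al q w⁻¹ w)

/-- the summand -/
def Gf (q : F) (a b c : ℕ) (u v w : F) : F :=
  u ^ a * v ^ b * w ^ c * (al q v u * al q w u * al q w v) * Kf q u v w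

lemma al_swap (q : F) {u v : F} (hu : u ≠ 0) (hv : v ≠ 0) : al q u⁻¹ v = al q v⁻¹ u := by
  unfold al
  rw [← mul_div_mul_left (v - q * u⁻¹) (v - u⁻¹) hu, ← mul_div_mul_left (u - q * v⁻¹) (u - v⁻¹) hv]
  congr 1 <;> field_simp

lemma Kf_swap12 (q : F) {u v w : F} (hu : u ≠ 0) (hv : v ≠ 0) :
    Kf q u v w = Kf q v u w := by
  unfold Kf; rw [al_swap q hu hv]; ring

lemma Kf_swap23 (q : F) {u v w : F} (hv : v ≠ 0) (hw : w ≠ 0) :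
    Kf q u v w = Kf q u w v := by
  unfold Kf; rw [al_swap q hv hw]; ring

lemma Gf_sum (q : F) (a b c : ℕ) {u v w : F} (hu : u ≠ 0) (hv : v ≠ 0) (hw : w ≠ 0) :
    Gf q a b c u v w + Gf q a b c u w v + Gf q a b c v u w + Gf q a b c v w u
      + Gf q a b c w u v + Gf q a b c w v u = Kf q u v w * HL q a b c u v w := by
  have e1 : Kf q u w v = Kf q u v w := Kf_swap23 q hw hv
  have e2 : Kf q v u w = Kf q u v w := Kf_swap12 q hv hu
  have e3 : Kf q v w u = Kf q u v w := by rw [Kf_swap23 q hw hu, e2]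
  have e4 : Kf q w u v = Kf q u v w := by rw [Kf_swap12 q hw hu, e1]
  have e5 : Kf q w v u = Kf q u v w := by rw [Kf_swap12 q hw hv, e3]
  unfold Gf HL
  rw [e1, e2, e3, e4, e5]
  ring

lemma HL_succ (q : F) (a b c : ℕ) (u v w : F) :
    HL q (a + 1) (b + 1) (c + 1) u v w = u * v * w * HL q a b c u v w := by
  unfold HL; ring

/-- sum over the signs -/
def Ssum (x : Fin 3 → F) (f : F → F → F → F) : F :=
  f (x 0) (x 1) (x 2) + f (x 0) (x 1) (x 2)⁻¹ + f (x 0) (x 1)⁻¹ (x 2)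
    + f (x 0) (x 1)⁻¹ (x 2)⁻¹ + f (x 0)⁻¹ (x 1) (x 2) + f (x 0)⁻¹ (x 1) (x 2)⁻¹
    + f (x 0)⁻¹ (x 1)⁻¹ (x 2) + f (x 0)⁻¹ (x 1)⁻¹ (x 2)⁻¹

lemma ofFn_M3 (l1 l2 l3 : ℕ) : List.ofFn (fun c : Fin (l1 + 1) =>
    (Finset.univ.filter (fun i => (![l1, l2, l3] : Fin 3 → ℕ) i = c.val)).card)
      = M3 l1 l2 l3 (l1 + 1) := by
  unfold M3
  congr 1
  funext c
  rw [Finset.card_filter, Fin.sum_univ_three]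
  rfl

lemma M3_sum (l1 l2 l3 : ℕ) (h21 : l2 ≤ l1) (h32 : l3 ≤ l2) :
    (M3 l1 l2 l3 (l1 + 1)).sum = 3 := by
  unfold M3
  have key : ∀ a, a < l1 + 1 → ∑ i : Fin (l1 + 1), (if a = i.val then 1 else 0) = 1 := by
    intro a ha
    rw [Finset.sum_eq_single ⟨a, ha⟩]
    · simp
    · intro b _ hb
      rw [if_neg]
      intro h; apply hb; ext; exact h.symm
    · simp
  rw [List.sum_ofFn, Finset.sum_add_distrib, Finset.sum_add_distrib, key _ (by omega),
    key _ (by omega), key _ (by omega)]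

lemma Gen3.nodup {x : Fin 3 → F} (h : Gen3 x) :
    [x 0, (x 0)⁻¹, x 1, (x 1)⁻¹, x 2, (x 2)⁻¹].Nodup := by
  have a : ∀ i, x i ≠ (x i)⁻¹ := by
    intro i e
    apply h.sq i
    rw [pow_two]; nth_rewrite 2 [e]; exact mul_inv_cancel₀ (h.ne0 i)
  have b : ∀ i j, i ≠ j → x i ≠ (x j)⁻¹ := by
    intro i j hij e
    apply h.mul i j hij
    rw [e]; exact inv_mul_cancel₀ (h.ne0 j)
  have b' : ∀ i j, i ≠ j → (x i)⁻¹ ≠ x j := fun i j hij e => b j i hij.symm e.symm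
  have c : ∀ i j, i ≠ j → (x i)⁻¹ ≠ (x j)⁻¹ := fun i j hij e => h.ne i j hij (inv_injective e)
  simp only [List.nodup_cons, List.mem_cons, List.not_mem_nil, or_false, not_or,
    not_false_eq_true, List.nodup_nil, and_true]
  refine ⟨⟨a 0, h.ne 0 1 (by decide), b 0 1 (by decide), h.ne 0 2 (by decide), b 0 2 (by decide)⟩,
    ⟨b' 0 1 (by decide), c 0 1 (by decide), b' 0 2 (by decide), c 0 2 (by decide)⟩,
    ⟨a 1, h.ne 1 2 (by decide), b 1 2 (by decide)⟩,
    ⟨b' 1 2 (by decide), c 1 2 (by decide)⟩, a 2⟩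

lemma Ssum_P3 (q : F) {x : Fin 3 → F} (h : Gen3 x) (l1 l2 l3 : ℕ) (h21 : l2 ≤ l1)
    (h32 : l3 ≤ l2) (k : F → F → F → F) :
    Ssum x (fun u v w => k u v w * P3 q u v w (M3 l1 l2 l3 (l1 + 1))) * cgen q l1 l2 l3
      = Ssum x (fun u v w => k u v w * (u * v * w * HL q l1 l2 l3 u v w)) := by
  have hd := h.nodup
  simp only [List.nodup_cons, List.mem_cons, List.not_mem_nil, or_false, not_or] at hd
  obtain ⟨⟨n1, n2, n3, n4, n5⟩, ⟨n6, n7, n8, n9⟩, ⟨n10, n11, n12⟩, ⟨n13, n14⟩, n15, -⟩ := hd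
  have P : ∀ {u v w : F}, u ≠ v → u ≠ w → v ≠ w →
      P3 q u v w (M3 l1 l2 l3 (l1 + 1)) * cgen q l1 l2 l3 = u * v * w * HL q l1 l2 l3 u v w :=
    fun a b c => P3_eval q a b c l3 l1 l2 (l1 + 1) h32 h21 (by omega)
  unfold Ssum
  beta_reduce
  rw [← P n2 n4 n11, ← P n2 n5 n12, ← P n3 n4 n13, ← P n3 n5 n14,
    ← P n6 n8 n11, ← P n6 n9 n12, ← P n7 n8 n13, ← P n7 n9 n14]
  ring

lemma be_al (q : F) {x : F} (hx : x ≠ 0) (hxx : x ^ 2 ≠ 1) :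
    be q x⁻¹ x + 1 = al q x x⁻¹ ∧ x⁻¹ * be q x⁻¹ x + q * x = x * al q x x⁻¹ := by
  have d3 : x ^ 2 - 1 ≠ 0 := sub_ne_zero.mpr hxx
  rw [(al_inv q hx hxx).2]
  have : be q x⁻¹ x = -((1 - q) * x ^ 2 / (x ^ 2 - 1)) := by
    unfold be
    rw [show x - x⁻¹ = (x ^ 2 - 1) / x by field_simp]; field_simp
  rw [this]
  constructor <;> field_simp <;> ring

theorem case1 (q : F) {x : Fin 3 → F} (h : Gen3 x) (l1 l2 l3 : ℕ) (h21 : l2 ≤ l1)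
    (h32 : l3 ≤ l2) (A C D : Fin 3 → F) (hA : A 0 = 0) (hD : D 2 = 0)
    (e1 : A 2 * D 0 = (1 - q ^ 2) * (C 0 * C 2)) (e2 : A 2 * D 1 = (1 - q ^ 2) * (C 1 * C 2))
    (e3 : A 1 * D 0 = (1 - q ^ 2) * (C 0 * C 1)) :
    ZBC ![l1, l2, l3] l1 q x A C C D * cgen q l1 l2 l3 = C 0 * C 1 * C 2 *
      Ssum x (fun u v w => Kf q u v w * HL q (l1 + 1) (l2 + 1) (l3 + 1) u v w) := by
  have m10 : x 1 * x 0 ≠ 1 := h.mul 1 0 (by decide)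
  have m20 : x 2 * x 0 ≠ 1 := h.mul 2 0 (by decide)
  have m21 : x 2 * x 1 ≠ 1 := h.mul 2 1 (by decide)
  have n10 : x 1 ≠ x 0 := h.ne 1 0 (by decide)
  have n20 : x 2 ≠ x 0 := h.ne 2 0 (by decide)
  have n21 : x 2 ≠ x 1 := h.ne 2 1 (by decide)
  have hl : ∀ i, C i * be q (x i)⁻¹ (x i) + C i = C i * al q (x i) (x i)⁻¹ := by
    intro i; rw [← (be_al q (h.ne0 i) (h.sq i)).1]; ring
  have j1 := idJ1 q (h.ne0 0) (h.ne0 1) (h.ne0 2) (h.sq 0) (h.sq 2) n20 m20 n21 m21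
  have g1 : x 2 ≠ (x 1)⁻¹ := by
    intro e; apply m21; rw [e]; exact inv_mul_cancel₀ (h.ne0 1)
  have g2 : x 2 * (x 1)⁻¹ ≠ 1 := by
    intro e; apply n21; rwa [mul_inv_eq_one₀ (h.ne0 1)] at e
  have j2 := idJ1 q (h.ne0 0) (inv_ne_zero (h.ne0 1)) (h.ne0 2) (h.sq 0) (h.sq 2) n20 m20 g1 g2
  rw [inv_inv] at j2
  rw [ZBC3_eq, ofFn_M3, hA, hD, combine_main q (x 0) (x 0)⁻¹ (x 1) (x 1)⁻¹ (x 2) (x 2)⁻¹ h.nodup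
    (C 0) (C 0) (D 0) (A 1) (C 1) (C 1) (D 1) (A 2) (C 2) (C 2)
    _ _ _ _ _ _ rfl (hl 0) rfl (hl 1) rfl (hl 2) ?_ ?_ ?_ ?_ _ (M3_sum _ _ _ h21 h32)]
  · have := Ssum_P3 q h l1 l2 l3 h21 h32 (fun u v w => C 0 * C 1 * C 2 * Kf q u v w)
    simp only [HL_succ]
    refine Eq.trans ?_ (this.trans ?_)
    · unfold Ssum Kf; simp only [inv_inv]; ring
    · unfold Ssum; ring
  · have i := idI1 q (h.ne0 1) (h.ne0 2) (h.sq 1) (h.sq 2) n21 m21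
    linear_combination (C 1 * C 2) * i + e2
  · have i := idI1 q (h.ne0 0) (h.ne0 1) (h.sq 0) (h.sq 1) n10 m10
    linear_combination (C 0 * C 1) * i + e3
  · linear_combination (C 0 * C 1 * C 2 * al q (x 1)⁻¹ (x 1)) * j1
      + C 1 * al q (x 1)⁻¹ (x 1) * e1 + (C 2 * al q (x 2)⁻¹ (x 2) * be q (x 1) (x 2)
        + C 2 * al q (x 2) (x 2)⁻¹ * be q (x 1) (x 2)⁻¹) * al q (x 1)⁻¹ (x 1) * e3
  · linear_combination (C 0 * C 1 * C 2 * al q (x 1) (x 1)⁻¹) * j2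
      + C 1 * al q (x 1) (x 1)⁻¹ * e1 + (C 2 * al q (x 2)⁻¹ (x 2) * be q (x 1)⁻¹ (x 2)
        + C 2 * al q (x 2) (x 2)⁻¹ * be q (x 1)⁻¹ (x 2)⁻¹) * al q (x 1) (x 1)⁻¹ * e3

theorem case2 (q : F) {x : Fin 3 → F} (h : Gen3 x) (l1 l2 l3 : ℕ) (h21 : l2 ≤ l1)
    (h32 : l3 ≤ l2) (A B C D m : Fin 3 → F) (hB : ∀ j, B j = q * m j * x j)
    (hC : ∀ j, C j = m j * (x j)⁻¹) (hA : A 0 = 0) (hD : D 2 = 0)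
    (e1 : A 2 * D 0 = (q ^ 5 - q ^ 3) * (m 0 * m 2)) (e2 : A 2 * D 1 = (q ^ 3 - q) * (m 1 * m 2))
    (e3 : A 1 * D 0 = (q ^ 3 - q) * (m 0 * m 1)) :
    ZBC ![l1, l2, l3] l1 q x A B C D * cgen q l1 l2 l3 = m 0 * m 1 * m 2 *
      Ssum x (fun u v w => Kf q u v w * HL q l1 l2 l3 u v w) := by
  have m10 : x 1 * x 0 ≠ 1 := h.mul 1 0 (by decide)
  have m20 : x 2 * x 0 ≠ 1 := h.mul 2 0 (by decide)
  have m21 : x 2 * x 1 ≠ 1 := h.mul 2 1 (by decide)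
  have n10 : x 1 ≠ x 0 := h.ne 1 0 (by decide)
  have n20 : x 2 ≠ x 0 := h.ne 2 0 (by decide)
  have n21 : x 2 ≠ x 1 := h.ne 2 1 (by decide)
  have hk : ∀ i, C i * al q (x i)⁻¹ (x i) = m i * (x i)⁻¹ * al q (x i)⁻¹ (x i) := by
    intro i; rw [hC]
  have hl : ∀ i, C i * be q (x i)⁻¹ (x i) + B i = m i * x i * al q (x i) (x i)⁻¹ := by
    intro i; rw [hC, hB]; linear_combination m i * (be_al q (h.ne0 i) (h.sq i)).2
  have j1 := idJ2 q (h.ne0 0) (h.ne0 1) (h.ne0 2) (h.sq 0) (h.sq 2) n20 m20 n21 m21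
  have g1 : x 2 ≠ (x 1)⁻¹ := by
    intro e; apply m21; rw [e]; exact inv_mul_cancel₀ (h.ne0 1)
  have g2 : x 2 * (x 1)⁻¹ ≠ 1 := by
    intro e; apply n21; rwa [mul_inv_eq_one₀ (h.ne0 1)] at e
  have j2 := idJ2 q (h.ne0 0) (inv_ne_zero (h.ne0 1)) (h.ne0 2) (h.sq 0) (h.sq 2) n20 m20 g1 g2
  rw [inv_inv] at j2
  rw [ZBC3_eq, ofFn_M3, hA, hD, combine_main q (x 0) (x 0)⁻¹ (x 1) (x 1)⁻¹ (x 2) (x 2)⁻¹ h.nodup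
    (B 0) (C 0) (D 0) (A 1) (B 1) (C 1) (D 1) (A 2) (B 2) (C 2)
    _ _ _ _ _ _ (hk 0) (hl 0) (hk 1) (hl 1) (hk 2) (hl 2) ?_ ?_ ?_ ?_ _ (M3_sum _ _ _ h21 h32)]
  · have := Ssum_P3 q h l1 l2 l3 h21 h32
      (fun u v w => m 0 * m 1 * m 2 * (u⁻¹ * v⁻¹ * w⁻¹) * Kf q u v w)
    refine Eq.trans ?_ (this.trans ?_)
    · unfold Ssum Kf; simp only [inv_inv]; ring
    · have c : ∀ u v w : F, u ≠ 0 → v ≠ 0 → w ≠ 0 →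
          m 0 * m 1 * m 2 * (u⁻¹ * v⁻¹ * w⁻¹) * Kf q u v w * (u * v * w * HL q l1 l2 l3 u v w)
          = m 0 * m 1 * m 2 * (Kf q u v w * HL q l1 l2 l3 u v w) := by
        intro u v w hu hv hw
        field_simp
      have p0 := h.ne0 0
      have p1 := h.ne0 1
      have p2 := h.ne0 2
      have r0 := inv_ne_zero p0
      have r1 := inv_ne_zero p1
      have r2 := inv_ne_zero p2
      unfold Ssum
      simp only [c _ _ _ p0 p1 p2, c _ _ _ p0 p1 r2, c _ _ _ p0 r1 p2, c _ _ _ p0 r1 r2,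
        c _ _ _ r0 p1 p2, c _ _ _ r0 p1 r2, c _ _ _ r0 r1 p2, c _ _ _ r0 r1 r2]
      ring
  · have i := idI2 q (h.ne0 1) (h.ne0 2) (h.sq 1) (h.sq 2) n21 m21
    linear_combination (m 1 * m 2) * i + e2
  · have i := idI2 q (h.ne0 0) (h.ne0 1) (h.sq 0) (h.sq 1) n10 m10
    linear_combination (m 0 * m 1) * i + e3
  · linear_combination (m 0 * m 1 * m 2 * al q (x 1)⁻¹ (x 1)) * j1
      + m 1 * (x 1)⁻¹ * al q (x 1)⁻¹ (x 1) * e1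
      + (m 2 * (x 2)⁻¹ * al q (x 2)⁻¹ (x 2) * be q (x 1) (x 2)
        + m 2 * x 2 * al q (x 2) (x 2)⁻¹ * be q (x 1) (x 2)⁻¹) * al q (x 1)⁻¹ (x 1) * e3
  · linear_combination (m 0 * m 1 * m 2 * al q (x 1) (x 1)⁻¹) * j2
      + m 1 * x 1 * al q (x 1) (x 1)⁻¹ * e1
      + (m 2 * (x 2)⁻¹ * al q (x 2)⁻¹ (x 2) * be q (x 1)⁻¹ (x 2)
        + m 2 * x 2 * al q (x 2) (x 2)⁻¹ * be q (x 1)⁻¹ (x 2)⁻¹) * al q (x 1) (x 1)⁻¹ * e3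

end final
section concrete

lemma poly_ne (p r : MvPolynomial (Fin 4) ℂ) (v : Fin 4 → ℂ)
    (h : MvPolynomial.eval v p ≠ MvPolynomial.eval v r) :
    algebraMap (MvPolynomial (Fin 4) ℂ) F3 p ≠ algebraMap (MvPolynomial (Fin 4) ℂ) F3 r := by
  intro e
  apply h
  rw [IsFractionRing.injective (MvPolynomial (Fin 4) ℂ) F3 e]

lemma gen3 : Gen3 x3v where
  ne0 i := by
    have := poly_ne (MvPolynomial.X i.succ) 0 (fun _ => 1) (by simp)
    rwa [map_zero] at this
  sq i := by
    have := poly_ne (MvPolynomial.X i.succ ^ 2) 1 (fun _ => 0) (by simp)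
    rwa [map_one, map_pow] at this
  ne i j hij := by
    refine poly_ne (MvPolynomial.X i.succ) (MvPolynomial.X j.succ)
      (fun k => if k = i.succ then 1 else 0) ?_
    simp [hij.symm]
  mul i j _ := by
    have := poly_ne (MvPolynomial.X i.succ * MvPolynomial.X j.succ) 1 (fun _ => 0) (by simp)
    rwa [map_one, map_mul] at this

lemma c3_eq (l1 l2 l3 : ℕ) : c3 l1 l2 l3 = cgen q3 l1 l2 l3 := rfl

lemma c3_ne (l1 l2 l3 : ℕ) : c3 l1 l2 l3 ≠ 0 := by
  have a : 1 + q3 ≠ 0 := by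
    have := poly_ne (1 + MvPolynomial.X 0) 0 (fun _ => 0) (by simp)
    rwa [map_zero, map_add, map_one] at this
  have b : 1 + q3 + q3 ^ 2 ≠ 0 := by
    have := poly_ne (1 + MvPolynomial.X 0 + MvPolynomial.X 0 ^ 2) 0 (fun _ => 0) (by simp)
    rwa [map_zero, map_add, map_add, map_pow, map_one] at this
  unfold c3
  split_ifs
  · exact mul_ne_zero a b
  · exact a
  · exact one_ne_zero

lemma perm3_sum (f : Fin 3 → Fin 3 → Fin 3 → F3) :
    ∑ σ : Equiv.Perm (Fin 3), f (σ 0) (σ 1) (σ 2)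
      = f 0 1 2 + f 0 2 1 + f 1 0 2 + f 1 2 0 + f 2 0 1 + f 2 1 0 := by
  have hu : (Finset.univ : Finset (Equiv.Perm (Fin 3))) = {1, Equiv.swap 1 2, Equiv.swap 0 1,
      Equiv.swap 0 1 * Equiv.swap 1 2, Equiv.swap 1 2 * Equiv.swap 0 1, Equiv.swap 0 2} := by
    decide
  rw [hu, Finset.sum_insert (by decide), Finset.sum_insert (by decide),
    Finset.sum_insert (by decide), Finset.sum_insert (by decide), Finset.sum_insert (by decide),
    Finset.sum_singleton]
  have e : ∀ (σ : Equiv.Perm (Fin 3)) (a b c : Fin 3), σ 0 = a → σ 1 = b → σ 2 = c →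
      f (σ 0) (σ 1) (σ 2) = f a b c := by
    rintro σ a b c rfl rfl rfl; rfl
  rw [e 1 0 1 2 (by decide) (by decide) (by decide),
    e (Equiv.swap 1 2) 0 2 1 (by decide) (by decide) (by decide),
    e (Equiv.swap 0 1) 1 0 2 (by decide) (by decide) (by decide),
    e (Equiv.swap 0 1 * Equiv.swap 1 2) 1 2 0 (by decide) (by decide) (by decide),
    e (Equiv.swap 1 2 * Equiv.swap 0 1) 2 0 1 (by decide) (by decide) (by decide),
    e (Equiv.swap 0 2) 2 1 0 (by decide) (by decide) (by decide)]
  ring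

lemma al_frac (q : F3) {u v : F3} (hu : u ≠ 0) :
    (1 - q * (v / u)) / (1 - v / u) = al q v u := by
  unfold al
  rw [← mul_div_mul_left (1 - q * (v / u)) (1 - v / u) hu]
  congr 1 <;> field_simp

lemma Tprod3_eq (y : Fin 3 → F3) (hy : ∀ i, y i ≠ 0) :
    Tprod3 y = (al q3 (y 1) (y 0) * al q3 (y 2) (y 0) * al q3 (y 2) (y 1))
      * Kf q3 (y 0) (y 1) (y 2) := by
  have r : ∀ u v : F3, (u * v)⁻¹ = u⁻¹ / v := by
    intro u v; rw [mul_inv, div_eq_mul_inv]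
  unfold Tprod3 Kf
  simp only [pow_two, r, al_frac q3 (hy 0), al_frac q3 (hy 1), al_frac q3 (hy 2)]
  ring

lemma WSum3_eq (a b c : ℕ) :
    WSum3 (fun y => y 0 ^ a * y 1 ^ b * y 2 ^ c * Tprod3 y)
      = Ssum x3v (fun u v w => Kf q3 u v w * HL q3 a b c u v w) := by
  unfold WSum3
  have hx : ∀ (i : Fin 3) (e : Bool), (if e then (x3v i)⁻¹ else x3v i) ≠ 0 := by
    intro i e
    cases e
    · exact gen3.ne0 i
    · exact inv_ne_zero (gen3.ne0 i)
  have hg : ∀ y : Fin 3 → F3, (∀ i, y i ≠ 0) →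
      y 0 ^ a * y 1 ^ b * y 2 ^ c * Tprod3 y = Gf q3 a b c (y 0) (y 1) (y 2) := by
    intro y hy
    rw [Tprod3_eq y hy]; unfold Gf; ring
  have hre : ∀ σ : Equiv.Perm (Fin 3), (∑ ε : Fin 3 → Bool,
      (fun y : Fin 3 → F3 => y 0 ^ a * y 1 ^ b * y 2 ^ c * Tprod3 y)
        (fun i => if ε i then (x3v (σ i))⁻¹ else x3v (σ i)))
      = ∑ ε : Fin 3 → Bool, Gf q3 a b c
        (if ε (σ 0) then (x3v (σ 0))⁻¹ else x3v (σ 0))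
        (if ε (σ 1) then (x3v (σ 1))⁻¹ else x3v (σ 1))
        (if ε (σ 2) then (x3v (σ 2))⁻¹ else x3v (σ 2)) := by
    intro σ
    rw [← (Equiv.arrowCongr σ.symm (Equiv.refl Bool)).sum_comp]
    apply Finset.sum_congr rfl
    intro ε _
    exact hg _ (fun i => hx _ _)
  simp only [hre]
  rw [Finset.sum_comm]
  have h6 : ∀ ε : Fin 3 → Bool, (∑ σ : Equiv.Perm (Fin 3), Gf q3 a b c
        (if ε (σ 0) then (x3v (σ 0))⁻¹ else x3v (σ 0))
        (if ε (σ 1) then (x3v (σ 1))⁻¹ else x3v (σ 1))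
        (if ε (σ 2) then (x3v (σ 2))⁻¹ else x3v (σ 2)))
      = (fun u v w => Kf q3 u v w * HL q3 a b c u v w)
        (if ε 0 then (x3v 0)⁻¹ else x3v 0) (if ε 1 then (x3v 1)⁻¹ else x3v 1)
        (if ε 2 then (x3v 2)⁻¹ else x3v 2) := by
    intro ε
    rw [perm3_sum (fun i j k => Gf q3 a b c (if ε i then (x3v i)⁻¹ else x3v i)
      (if ε j then (x3v j)⁻¹ else x3v j) (if ε k then (x3v k)⁻¹ else x3v k))]
    exact Gf_sum q3 a b c (hx _ _) (hx _ _) (hx _ _)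
  simp only [h6]
  have s3 : ∀ g : (Fin 3 → Bool) → F3, ∑ h, g h = ∑ a0, ∑ a1, ∑ a2, g ![a0, a1, a2] := by
    intro g
    simp only [sum_cons_fun]
    simp
    rfl
  rw [s3]
  simp [Ssum]
  ring

end concrete

/-- Rank-three evaluation: zonal spherical function (Theorem 7.2). -/
theorem stmt14 (l1 l2 l3 : ℕ) (h21 : l2 ≤ l1) (h32 : l3 ≤ l2)
    (A B C D : Fin 3 → F3) :
    (((∀ j, B j = C j) ∧ (∀ j, IsPolyQ3 (A j)) ∧ (∀ j, IsPolyQ3 (C j)) ∧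
        (∀ j, IsPolyQ3 (D j)) ∧ (∀ j, C j ≠ 0) ∧ A 0 = 0 ∧ D 2 = 0 ∧
        A 2 * C 1 * D 0 = (1 - q3 ^ 2) * (C 0 * C 1 * C 2) ∧
        A 2 * C 0 * D 1 = (1 - q3 ^ 2) * (C 0 * C 1 * C 2) ∧
        A 1 * C 2 * D 0 = (1 - q3 ^ 2) * (C 0 * C 1 * C 2)) →
      ZBC ![l1, l2, l3] l1 q3 x3v A B C D
        = (C 0 * C 1 * C 2 / c3 l1 l2 l3) *
            WSum3 (fun y =>
              y 0 ^ (l1 + 1) * y 1 ^ (l2 + 1) * y 2 ^ (l3 + 1) * Tprod3 y)) ∧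
    (∀ m : Fin 3 → F3, (∀ j, IsPolyQ3 (m j)) → (∀ j, m j ≠ 0) →
      (∀ j, B j = q3 * m j * x3v j) → (∀ j, C j = m j * (x3v j)⁻¹) →
      (∀ j, IsPolyQ3 (A j)) → (∀ j, IsPolyQ3 (D j)) →
      A 0 = 0 → D 2 = 0 →
      m 0 * A 2 * D 1 = (q3 ^ 3 - q3) * (m 0 * m 1 * m 2) →
      m 2 * A 1 * D 0 = (q3 ^ 3 - q3) * (m 0 * m 1 * m 2) →
      m 1 * A 2 * D 0 = (q3 ^ 5 - q3 ^ 3) * (m 0 * m 1 * m 2) →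
      ZBC ![l1, l2, l3] l1 q3 x3v A B C D
        = (m 0 * m 1 * m 2 / c3 l1 l2 l3) *
            WSum3 (fun y => y 0 ^ l1 * y 1 ^ l2 * y 2 ^ l3 * Tprod3 y)) := by
  have hc := c3_ne l1 l2 l3
  have fin : ∀ Z K S : F3, Z * c3 l1 l2 l3 = K * S → Z = K / c3 l1 l2 l3 * S := by
    intro Z K S h
    field_simp
    exact h
  constructor
  · rintro ⟨hB, -, -, -, hC, hA, hD, e1, e2, e3⟩
    have hBC : B = C := funext hB
    subst hBC
    rw [WSum3_eq]
    apply fin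
    rw [c3_eq]
    refine case1 q3 gen3 l1 l2 l3 h21 h32 A B D hA hD ?_ ?_ ?_
    · apply mul_left_cancel₀ (hC 1); linear_combination e1
    · apply mul_left_cancel₀ (hC 0); linear_combination e2
    · apply mul_left_cancel₀ (hC 2); linear_combination e3
  · intro m _ hm hB hC _ _ hA hD e2 e3 e1
    rw [WSum3_eq]
    apply fin
    rw [c3_eq]
    refine case2 q3 gen3 l1 l2 l3 h21 h32 A B C D m hB hC hA hD ?_ ?_ ?_
    · apply mul_left_cancel₀ (hm 1); linear_combination e1
    · apply mul_left_cancel₀ (hm 0); linear_combination e2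
    · apply mul_left_cancel₀ (hm 2); linear_combination e3
end
end

section
/- Higher-rank rigidity (core of Proposition 8.1, regime 1(a)): Let r ≥ 4 and let A_j, C_j, D_j ∈ ℂ[q] for j = 1, …, r with C_j ≠ 0 for every j. Assume: (i) q²(A_j·D_{j+1} − C_j·C_{j+1}) = A_{j+1}·D_j − C_j·C_{j+1} for all 1 ≤ j ≤ r−1; (ii) A_j·C_k·D_{k+1} = A_j·C_{k+1}·D_k for all 1 ≤ k ≤ r−1 and all j ∉ {k, k+1}; and (iii) C_k·A_{k+1}·D_j = A_k·C_{k+1}·D_j for all 1 ≤ k ≤ r−1 and all j ∉ {k, k+1}. Then A_i·D_j = C_i·C_j for all i ≠ j; in particular A_j ≠ 0 and D_j ≠ 0 for every j. (Consequently, in rank r ≥ 4, unlike in ranks 2 and 3, no solvable type B/C model in regime 1(a) with nonzero C-weights can have any vanishing A- or D-bend weight, which is the obstruction to realizing the zonal spherical function in higher rank.) -/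
open Polynomial

theorem pair_aux {K : Type*} [Field K] (t : K) (r : ℕ) (a d : ℕ → K)
    (h1 : ∀ j, j + 1 < r → t * (a j * d (j + 1) - 1) = a (j + 1) * d j - 1) (ht : t ≠ 1)
    (h2 : ∀ i k, i < r → k + 1 < r → i ≠ k → i ≠ k + 1 → a i ≠ 0 → d k = d (k + 1))
    (h3 : ∀ i k, i < r → k + 1 < r → i ≠ k → i ≠ k + 1 → d i ≠ 0 → a k = a (k + 1))
    (k l : ℕ) (hk : k + 1 < r) (hl : l + 1 < r) (hkl : k + 1 < l ∨ l + 1 < k) :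
    a k = a (k + 1) ∧ d k = d (k + 1) ∧ a k * d k = 1 := by
  have hne : (a l ≠ 0 ∧ d (l + 1) ≠ 0) ∨ (a (l + 1) ≠ 0 ∧ d l ≠ 0) := by
    by_contra hcon
    have e1 : a l * d (l + 1) = 0 := by
      by_contra h
      exact hcon (Or.inl (mul_ne_zero_iff.mp h))
    have e2 : a (l + 1) * d l = 0 := by
      by_contra h
      exact hcon (Or.inr (mul_ne_zero_iff.mp h))
    have := h1 l hl
    rw [e1, e2] at this
    apply ht
    linear_combination -this
  have hd : d k = d (k + 1) := by
    rcases hne with h | h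
    · exact h2 l k (by omega) hk (by omega) (by omega) h.1
    · exact h2 (l + 1) k (by omega) hk (by omega) (by omega) h.1
  have ha : a k = a (k + 1) := by
    rcases hne with h | h
    · exact h3 (l + 1) k (by omega) hk (by omega) (by omega) h.2
    · exact h3 l k (by omega) hk (by omega) (by omega) h.2
  refine ⟨ha, hd, ?_⟩
  have h := h1 k hk
  rw [← ha, ← hd] at h
  have h' : (t - 1) * (a k * d k - 1) = 0 := by linear_combination h
  rcases mul_eq_zero.mp h' with h | h
  · exact absurd (sub_eq_zero.mp h) ht
  · exact sub_eq_zero.mp h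

theorem field_aux {K : Type*} [Field K] (t : K) (r : ℕ) (hr : 4 ≤ r) (a d : ℕ → K)
    (h1 : ∀ j, j + 1 < r → t * (a j * d (j + 1) - 1) = a (j + 1) * d j - 1) (ht : t ≠ 1)
    (h2 : ∀ i k, i < r → k + 1 < r → i ≠ k → i ≠ k + 1 → a i ≠ 0 → d k = d (k + 1))
    (h3 : ∀ i k, i < r → k + 1 < r → i ≠ k → i ≠ k + 1 → d i ≠ 0 → a k = a (k + 1)) :
    ∀ i j, i < r → j < r → a i * d j = 1 := by
  have P := pair_aux t r a d h1 ht h2 h3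
  have hdiag : ∀ j, j < r → a j * d j = 1 := by
    intro j hj
    by_cases h0 : j = 0
    · subst h0; exact (P 0 2 (by omega) (by omega) (by omega)).2.2
    by_cases h2' : j = 2
    · subst h2'; exact (P 2 0 (by omega) (by omega) (by omega)).2.2
    obtain ⟨m, rfl⟩ : ∃ m, j = m + 1 := ⟨j - 1, by omega⟩
    have : a m = a (m + 1) ∧ d m = d (m + 1) ∧ a m * d m = 1 := by
      by_cases hm : m = 0
      · exact P m 2 (by omega) (by omega) (by omega)
      · exact P m 0 (by omega) (by omega) (by omega)
    rw [← this.1, ← this.2.1]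
    exact this.2.2
  have hd : ∀ j, j < r → d j = d 0 := by
    intro j
    induction j with
    | zero => intro _; rfl
    | succ m ih =>
      intro hm
      rw [← ih (by omega)]
      symm
      obtain ⟨i, hi, hi1, hi2⟩ : ∃ i, i < r ∧ i ≠ m ∧ i ≠ m + 1 := by
        by_cases h : m < 2
        · exact ⟨3, by omega, by omega, by omega⟩
        · exact ⟨0, by omega, by omega, by omega⟩
      exact h2 i m hi hm hi1 hi2 (left_ne_zero_of_mul_eq_one (hdiag i hi))
  intro i j hi hj
  rw [hd j hj, ← hd i hi]
  exact hdiag i hi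

/-- Higher-rank rigidity (core of Proposition 8.1, regime 1(a)): for rank `r ≥ 4`,
the caduceus constraint system over `ℂ[q]` (with `q = X`) forces `A_i·D_j = C_i·C_j`
for all `i ≠ j`; in particular no `A`- or `D`-bend weight can vanish. -/
theorem stmt16 (r : ℕ) (hr : 4 ≤ r) (A C D : Fin r → Polynomial ℂ)
    (hC : ∀ j, C j ≠ 0)
    (h1 : ∀ (j : ℕ) (hj : j + 1 < r),
      (X : Polynomial ℂ) ^ 2 *
          (A ⟨j, by omega⟩ * D ⟨j + 1, hj⟩ - C ⟨j, by omega⟩ * C ⟨j + 1, hj⟩)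
        = A ⟨j + 1, hj⟩ * D ⟨j, by omega⟩ - C ⟨j, by omega⟩ * C ⟨j + 1, hj⟩)
    (h2 : ∀ (i : Fin r) (k : ℕ) (hk : k + 1 < r), i.val ≠ k → i.val ≠ k + 1 →
      A i * C ⟨k, by omega⟩ * D ⟨k + 1, hk⟩ = A i * C ⟨k + 1, hk⟩ * D ⟨k, by omega⟩)
    (h3 : ∀ (i : Fin r) (k : ℕ) (hk : k + 1 < r), i.val ≠ k → i.val ≠ k + 1 →
      C ⟨k, by omega⟩ * A ⟨k + 1, hk⟩ * D i = A ⟨k, by omega⟩ * C ⟨k + 1, hk⟩ * D i) :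
    (∀ i j : Fin r, i ≠ j → A i * D j = C i * C j) ∧
    (∀ j, A j ≠ 0 ∧ D j ≠ 0) := by
  have hinj : Function.Injective (algebraMap (Polynomial ℂ) (RatFunc ℂ)) :=
    IsFractionRing.injective _ _
  set φ := algebraMap (Polynomial ℂ) (RatFunc ℂ) with hφ
  have hC' : ∀ j, φ (C j) ≠ 0 := fun j h => hC j (hinj (by rw [h, map_zero]))
  have key := field_aux (φ (X ^ 2)) r hr
    (fun j => if h : j < r then φ (A ⟨j, h⟩) / φ (C ⟨j, h⟩) else 0)
    (fun j => if h : j < r then φ (D ⟨j, h⟩) / φ (C ⟨j, h⟩) else 0)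
    (by
      intro j hj
      have hj' : j < r := by omega
      simp only [hj, hj', dif_pos]
      have e := congrArg φ (h1 j hj)
      simp only [map_mul, map_sub] at e
      have c1 := hC' ⟨j, hj'⟩
      have c2 := hC' ⟨j + 1, hj⟩
      field_simp
      linear_combination e)
    (by
      intro h
      rw [← map_one φ] at h
      have h' := congrArg (Polynomial.eval 0) (hinj h)
      simp at h')
    (by
      intro i k hi hk hik hik' hne
      have hk' : k < r := by omega
      simp only [hi, hk, hk', dif_pos] at hne ⊢
      have c1 := hC' ⟨k, hk'⟩
      have c2 := hC' ⟨k + 1, hk⟩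
      have hA : φ (A ⟨i, hi⟩) ≠ 0 := fun h => hne (by rw [h, zero_div])
      have e := congrArg φ (h2 ⟨i, hi⟩ k hk hik hik')
      simp only [map_mul] at e
      rw [div_eq_div_iff c1 c2]
      apply mul_left_cancel₀ hA
      linear_combination -e)
    (by
      intro i k hi hk hik hik' hne
      have hk' : k < r := by omega
      simp only [hi, hk, hk', dif_pos] at hne ⊢
      have c1 := hC' ⟨k, hk'⟩
      have c2 := hC' ⟨k + 1, hk⟩
      have hD : φ (D ⟨i, hi⟩) ≠ 0 := fun h => hne (by rw [h, zero_div])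
      have e := congrArg φ (h3 ⟨i, hi⟩ k hk hik hik')
      simp only [map_mul] at e
      rw [div_eq_div_iff c1 c2]
      apply mul_left_cancel₀ hD
      linear_combination -e)
  have main : ∀ i j : Fin r, A i * D j = C i * C j := by
    intro i j
    have e := key i j i.2 j.2
    simp only [i.2, j.2, dif_pos, Fin.eta] at e
    apply hinj
    have c1 := hC' i
    have c2 := hC' j
    rw [div_mul_div_comm, div_eq_one_iff_eq (mul_ne_zero c1 c2)] at e
    rw [map_mul, map_mul]
    exact e
  refine ⟨fun i j _ => main i j, fun j => ?_⟩
  have h : A j * D j ≠ 0 := by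
    rw [main j j]
    exact mul_ne_zero (hC j) (hC j)
  exact mul_ne_zero_iff.mp h
end
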